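/- arXiv:2011.07767 — 4 statements merged into one kernel-verified Lean document; each statement's English description precedes it below -/
import Mathlib

section
/- Let q, a, b be complex numbers with |q| < 1, |a| < 1, |b| < 1, a ≠ 0, and 1 - b q^n ≠ 0 for all n ≥ 0. Then ∑_{n=1}^∞ ( (b/a;q)_n a^n ) / ( (1 - q^n) (b;q)_n ) = ∑_{n=1}^∞ (a^n - b^n)/(1 - q^n). -/
/-- The finite q-Pochhammer symbol `(A;q)_n = (1-A)(1-Aq)⋯(1-Aq^{n-1})`. -/
noncomputable def qPoch (q A : ℂ) (n : ℕ) : ℂ := ∏ k ∈ Finset.range n, (1 - A * q ^ k)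

/-- The infinite q-Pochhammer symbol `(A;q)_∞ = ∏_{k≥0} (1 - A q^k)`. -/
noncomputable def qPochInf (q A : ℂ) : ℂ := ∏' k : ℕ, (1 - A * q ^ k)

open Filter Topology

/-- The product `∏_{k<n} (x - b q^k)`, which equals `(b/x;q)_n x^n` for `x ≠ 0`. -/
noncomputable def shiftedProd (q b x : ℂ) (n : ℕ) : ℂ := ∏ k ∈ Finset.range n, (x - b * q ^ k)

lemma qPoch_succ (q b : ℂ) (n : ℕ) : qPoch q b (n + 1) = qPoch q b n * (1 - b * q ^ n) :=
  Finset.prod_range_succ _ _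

lemma shiftedProd_succ (q b x : ℂ) (n : ℕ) :
    shiftedProd q b x (n + 1) = shiftedProd q b x n * (x - b * q ^ n) :=
  Finset.prod_range_succ _ _

lemma qPoch_div_mul_pow (q b x : ℂ) (hx : x ≠ 0) (n : ℕ) :
    qPoch q (b / x) n * x ^ n = shiftedProd q b x n := by
  induction n with
  | zero => simp [qPoch, shiftedProd]
  | succ n ih =>
    rw [qPoch_succ, shiftedProd_succ, ← ih]
    field_simp
    ring

lemma qPoch_ne_zero {q b : ℂ} (hb : ∀ n : ℕ, 1 - b * q ^ n ≠ 0) (n : ℕ) : qPoch q b n ≠ 0 :=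
  Finset.prod_ne_zero_iff.mpr fun k _ => hb k

lemma shiftedProd_mul_succ (q b x : ℂ) (n : ℕ) :
    shiftedProd q b (x * q) (n + 1) = q ^ n * (x * q - b) * shiftedProd q b x n := by
  induction n with
  | zero => simp [shiftedProd]
  | succ n ih =>
    rw [shiftedProd_succ, ih, shiftedProd_succ]
    ring

lemma shiftedProd_succ_sub (q b x : ℂ) (n : ℕ) :
    shiftedProd q b x (n + 1) - shiftedProd q b (x * q) (n + 1)
      = x * (1 - q ^ (n + 1)) * shiftedProd q b x n := by
  rw [shiftedProd_mul_succ, shiftedProd_succ]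
  ring

lemma one_sub_pow_succ_ne_zero {q : ℂ} (hq : ‖q‖ < 1) (n : ℕ) : 1 - q ^ (n + 1) ≠ 0 := by
  intro h
  have h1 : ‖q ^ (n + 1)‖ = 1 := by rw [← sub_eq_zero.mp h]; simp
  rw [norm_pow] at h1
  exact (pow_lt_one₀ (norm_nonneg q) hq (Nat.succ_ne_zero n)).ne h1

/-- A majorant of `shiftedProd q b x n / qPoch q b n` on the disc `‖x‖ ≤ r`. -/
noncomputable def ratioMajorant (q b : ℂ) (r : ℝ) (n : ℕ) : ℝ :=
  ∏ k ∈ Finset.range n, ((r + ‖b‖ * ‖q‖ ^ k) / ‖1 - b * q ^ k‖)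

lemma norm_shiftedProd_div_le (q b x : ℂ) {r : ℝ} (hx : ‖x‖ ≤ r) (n : ℕ) :
    ‖shiftedProd q b x n / qPoch q b n‖ ≤ ratioMajorant q b r n := by
  rw [shiftedProd, qPoch, ← Finset.prod_div_distrib, norm_prod]
  refine Finset.prod_le_prod (fun _ _ => norm_nonneg _) fun k _ => ?_
  rw [norm_div]
  gcongr
  calc ‖x - b * q ^ k‖ ≤ ‖x‖ + ‖b * q ^ k‖ := norm_sub_le _ _
    _ ≤ r + ‖b‖ * ‖q‖ ^ k := by rw [norm_mul, norm_pow]; gcongr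

lemma summable_ratioMajorant {q b : ℂ} (hq : ‖q‖ < 1) (hb : ∀ n : ℕ, 1 - b * q ^ n ≠ 0)
    {r : ℝ} (hr0 : 0 < r) (hr1 : r < 1) : Summable (ratioMajorant q b r) := by
  have hpos : ∀ k, 0 < (r + ‖b‖ * ‖q‖ ^ k) / ‖1 - b * q ^ k‖ := fun k =>
    div_pos (by positivity) (norm_pos_iff.mpr (hb k))
  have hM : ∀ n, 0 < ratioMajorant q b r n := fun n => Finset.prod_pos fun k _ => hpos k
  refine summable_of_ratio_test_tendsto_lt_one hr1 (Eventually.of_forall fun n => (hM n).ne') ?_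
  have h1 : Tendsto (fun k : ℕ => (r + ‖b‖ * ‖q‖ ^ k) / ‖1 - b * q ^ k‖) atTop
      (𝓝 ((r + ‖b‖ * 0) / ‖1 - b * 0‖)) := by
    refine Tendsto.div ?_ ?_ (by simp)
    · exact ((tendsto_pow_atTop_nhds_zero_of_lt_one (norm_nonneg q) hq).const_mul _).const_add _
    · exact (((tendsto_pow_atTop_nhds_zero_of_norm_lt_one hq).const_mul _).const_sub _).norm
  simp only [mul_zero, add_zero, sub_zero, norm_one, div_one] at h1
  refine h1.congr fun n => ?_
  rw [Real.norm_of_nonneg (hM _).le, Real.norm_of_nonneg (hM _).le, eq_div_iff (hM n).ne', mul_comm]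
  exact (Finset.prod_range_succ _ _).symm

lemma norm_div_one_sub_pow_succ_le {q : ℂ} (hq : ‖q‖ < 1) (z : ℂ) (n : ℕ) :
    ‖z / (1 - q ^ (n + 1))‖ ≤ ‖z‖ / (1 - ‖q‖) := by
  rw [norm_div]
  have h : ‖q ^ (n + 1)‖ ≤ ‖q‖ := by
    rw [norm_pow]
    exact pow_le_of_le_one (norm_nonneg q) hq.le (Nat.succ_ne_zero n)
  have h2 : ‖(1 : ℂ)‖ - ‖q ^ (n + 1)‖ ≤ ‖1 - q ^ (n + 1)‖ := norm_sub_norm_le _ _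
  rw [norm_one] at h2
  have h3 : 0 < 1 - ‖q‖ := by linarith
  gcongr
  linarith

lemma exists_radius {x : ℂ} (hx : ‖x‖ < 1) : ∃ r : ℝ, 0 < r ∧ r < 1 ∧ ‖x‖ ≤ r :=
  ⟨(1 + ‖x‖) / 2, by positivity, by linarith, by linarith⟩

lemma summable_shiftedProd_div {q b x : ℂ} (hq : ‖q‖ < 1) (hb : ∀ n : ℕ, 1 - b * q ^ n ≠ 0)
    (hx : ‖x‖ < 1) : Summable fun n => shiftedProd q b x n / qPoch q b n := by
  obtain ⟨r, hr0, hr1, hr⟩ := exists_radius hx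
  exact (summable_ratioMajorant hq hb hr0 hr1).of_norm_bounded
    (norm_shiftedProd_div_le q b x hr)

lemma hasSum_shiftedProd_div_succ {q b x : ℂ} (hq : ‖q‖ < 1)
    (hb : ∀ n : ℕ, 1 - b * q ^ n ≠ 0) (hx : ‖x‖ < 1) :
    HasSum (fun n => shiftedProd q b x n / qPoch q b (n + 1)) (1 - x)⁻¹ := by
  have hs := summable_shiftedProd_div hq hb hx
  have hx1 : 1 - x ≠ 0 := by
    intro h
    rw [← sub_eq_zero.mp h] at hx
    simp at hx
  have h0 : HasSum (fun n => shiftedProd q b x (n + 1) / qPoch q b (n + 1))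
      (∑' n, shiftedProd q b x n / qPoch q b n - 1) := by
    have := (hasSum_nat_add_iff' 1).mpr hs.hasSum
    simpa [shiftedProd, qPoch] using this
  have h := (hs.hasSum.sub h0).mul_left (1 - x)⁻¹
  rw [sub_sub_cancel, mul_one] at h
  refine h.congr_fun fun n => ?_
  have h1 := qPoch_ne_zero hb n
  have h2 := hb n
  rw [shiftedProd_succ, qPoch_succ]
  field_simp
  ring

/-- Termwise difference of the two series in the theorem, with `a` replaced by `x`. -/
noncomputable def diffTerm (q b x : ℂ) (n : ℕ) : ℂ :=
  shiftedProd q b x (n + 1) / qPoch q b (n + 1) / (1 - q ^ (n + 1))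
    - (x ^ (n + 1) - b ^ (n + 1)) / (1 - q ^ (n + 1))

lemma summable_shiftedProd_series {q b x : ℂ} (hq : ‖q‖ < 1)
    (hb : ∀ n : ℕ, 1 - b * q ^ n ≠ 0) (hx : ‖x‖ < 1) :
    Summable fun n => shiftedProd q b x (n + 1) / qPoch q b (n + 1) / (1 - q ^ (n + 1)) := by
  have h := (summable_nat_add_iff (f := fun n => shiftedProd q b x n / qPoch q b n) 1).mpr
    (summable_shiftedProd_div hq hb hx)
  exact (h.norm.div_const (1 - ‖q‖)).of_norm_bounded
    fun n => norm_div_one_sub_pow_succ_le hq _ n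

lemma summable_pow_sub_pow_series {q b x : ℂ} (hq : ‖q‖ < 1) (hbb : ‖b‖ < 1) (hx : ‖x‖ < 1) :
    Summable fun n : ℕ => (x ^ (n + 1) - b ^ (n + 1)) / (1 - q ^ (n + 1)) := by
  have h : Summable fun n : ℕ => x ^ (n + 1) - b ^ (n + 1) :=
    ((summable_nat_add_iff (f := fun n => x ^ n) 1).mpr
      (summable_geometric_of_norm_lt_one hx)).sub
      ((summable_nat_add_iff (f := fun n => b ^ n) 1).mpr (summable_geometric_of_norm_lt_one hbb))
  exact (h.norm.div_const (1 - ‖q‖)).of_norm_bounded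
    fun n => norm_div_one_sub_pow_succ_le hq _ n

lemma summable_diffTerm {q b x : ℂ} (hq : ‖q‖ < 1) (hbb : ‖b‖ < 1)
    (hb : ∀ n : ℕ, 1 - b * q ^ n ≠ 0) (hx : ‖x‖ < 1) : Summable (diffTerm q b x) :=
  (summable_shiftedProd_series hq hb hx).sub (summable_pow_sub_pow_series hq hbb hx)

lemma norm_mul_lt_one {q x : ℂ} (hq : ‖q‖ < 1) (hx : ‖x‖ < 1) : ‖x * q‖ < 1 := by
  rw [norm_mul]
  exact mul_lt_one_of_nonneg_of_lt_one_left (norm_nonneg x) hx hq.le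

lemma tsum_diffTerm_mul {q b x : ℂ} (hq : ‖q‖ < 1) (hbb : ‖b‖ < 1)
    (hb : ∀ n : ℕ, 1 - b * q ^ n ≠ 0) (hx : ‖x‖ < 1) :
    ∑' n, diffTerm q b (x * q) n = ∑' n, diffTerm q b x n := by
  have h := ((hasSum_shiftedProd_div_succ hq hb hx).sub
    (hasSum_geometric_of_norm_lt_one hx)).mul_left x
  rw [sub_self, mul_zero] at h
  have h2 := (summable_diffTerm hq hbb hb hx).hasSum.sub
    (summable_diffTerm hq hbb hb (norm_mul_lt_one hq hx)).hasSum
  refine (sub_eq_zero.mp (h2.unique (h.congr_fun fun n => ?_))).symm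
  have hn := one_sub_pow_succ_ne_zero hq n
  have hp := qPoch_ne_zero hb (n + 1)
  have hd := shiftedProd_succ_sub q b x n
  simp only [diffTerm]
  rw [sub_eq_iff_eq_add.mp hd, mul_pow]
  field_simp
  ring

lemma continuousOn_tsum_diffTerm {q b : ℂ} (hq : ‖q‖ < 1) (hbb : ‖b‖ < 1)
    (hb : ∀ n : ℕ, 1 - b * q ^ n ≠ 0) {r : ℝ} (hr0 : 0 < r) (hr1 : r < 1) :
    ContinuousOn (fun x => ∑' n, diffTerm q b x n) (Metric.closedBall 0 r) := by
  have hM := (summable_nat_add_iff 1).mpr (summable_ratioMajorant hq hb hr0 hr1)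
  have hg := ((summable_nat_add_iff 1).mpr (summable_geometric_of_lt_one hr0.le hr1)).add
    ((summable_nat_add_iff 1).mpr (summable_geometric_of_lt_one (norm_nonneg b) hbb))
  refine continuousOn_tsum (fun n => ?_) ((hM.add hg).div_const (1 - ‖q‖)) fun n x hx => ?_
  · unfold diffTerm shiftedProd
    fun_prop
  · have hx' : ‖x‖ ≤ r := by simpa using hx
    rw [diffTerm, ← sub_div]
    refine (norm_div_one_sub_pow_succ_le hq _ n).trans ?_
    have h3 : 0 < 1 - ‖q‖ := by linarith
    gcongr
    refine (norm_sub_le _ _).trans (add_le_add (norm_shiftedProd_div_le q b x hx' _) ?_)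
    refine (norm_sub_le _ _).trans ?_
    rw [norm_pow, norm_pow]
    gcongr

lemma tsum_diffTerm_eq_zero_arg {q b x : ℂ} (hq : ‖q‖ < 1) (hbb : ‖b‖ < 1)
    (hb : ∀ n : ℕ, 1 - b * q ^ n ≠ 0) (hx : ‖x‖ < 1) :
    ∑' n, diffTerm q b x n = ∑' n, diffTerm q b 0 n := by
  have hlt : ∀ N : ℕ, ‖x * q ^ N‖ < 1 := fun N => by
    induction N with
    | zero => simpa using hx
    | succ N ih => rw [pow_succ, ← mul_assoc]; exact norm_mul_lt_one hq ih
  have hconst : ∀ N : ℕ, ∑' n, diffTerm q b (x * q ^ N) n = ∑' n, diffTerm q b x n := fun N => by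
    induction N with
    | zero => simp
    | succ N ih => rw [pow_succ, ← mul_assoc, tsum_diffTerm_mul hq hbb hb (hlt N), ih]
  have hcont : ContinuousAt (fun x => ∑' n, diffTerm q b x n) 0 :=
    (continuousOn_tsum_diffTerm hq hbb hb (r := 1 / 2) (by norm_num) (by norm_num)).continuousAt
      (Metric.closedBall_mem_nhds 0 (by norm_num))
  have hlim : Tendsto (fun N : ℕ => x * q ^ N) atTop (𝓝 0) := by
    simpa using (tendsto_pow_atTop_nhds_zero_of_norm_lt_one hq).const_mul x
  refine tendsto_nhds_unique ?_ (hcont.tendsto.comp hlim)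
  exact tendsto_const_nhds.congr fun N => (hconst N).symm

lemma diffTerm_self (q b : ℂ) (n : ℕ) : diffTerm q b b n = 0 := by
  have h : shiftedProd q b b (n + 1) = 0 :=
    Finset.prod_eq_zero (i := 0) (by simp) (by simp)
  simp [diffTerm, h]

theorem stmt12 (q a b : ℂ) (hq : ‖q‖ < 1) (haa : ‖a‖ < 1) (hbb : ‖b‖ < 1)
    (ha : a ≠ 0) (hb : ∀ n : ℕ, 1 - b * q ^ n ≠ 0) :
    ∑' n : ℕ, (qPoch q (b / a) (n + 1) * a ^ (n + 1)) /
        ((1 - q ^ (n + 1)) * qPoch q b (n + 1))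
      = ∑' n : ℕ, (a ^ (n + 1) - b ^ (n + 1)) / (1 - q ^ (n + 1)) := by
  have h : ∑' n, diffTerm q b a n = 0 := by
    rw [tsum_diffTerm_eq_zero_arg hq hbb hb haa, ← tsum_diffTerm_eq_zero_arg hq hbb hb hbb]
    simp [diffTerm_self]
  simp only [diffTerm] at h
  rw [(summable_shiftedProd_series hq hb haa).tsum_sub
    (summable_pow_sub_pow_series hq hbb haa), sub_eq_zero] at h
  rw [← h]
  refine tsum_congr fun n => ?_
  rw [qPoch_div_mul_pow q b a ha, div_div, mul_comm (1 - q ^ (n + 1))]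
end

section
/- For every positive integer n and every complex number a with a ≠ 1, one has ∑_{π ∈ D(n)} (-1)^{#(π)-1} a^{ℓ(π)-s(π)+1} · (a^{s(π)} - 1)/(a - 1) = ∑_{d | n} a^d, where the sum on the right runs over the positive divisors d of n. Equivalently, ∑_{π ∈ D(n)} (-1)^{#(π)-1} ∑_{j=1}^{s(π)} a^{ℓ(π)-s(π)+j} = ∑_{d | n} a^d holds for every complex number a. -/
open Finset

open scoped Classical

/-- The largest part `ℓ(π)` of a partition. -/
def largestPart {n : ℕ} (p : n.Partition) : ℕ := p.parts.toFinset.sup id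

/-- The smallest part `s(π)` of a partition. -/
noncomputable def smallestPart {n : ℕ} (p : n.Partition) : ℕ := sInf {j | j ∈ p.parts}

/-- The number of parts `#(π)` of a partition. -/
def numParts {n : ℕ} (p : n.Partition) : ℕ := Multiset.card p.parts

/-- `ν(j)`: the multiplicity of `j` as a part of the partition. -/
def mult {n : ℕ} (p : n.Partition) (j : ℕ) : ℕ := p.parts.count j

/-- `ν_d(π)`: the number of distinct parts of the partition. -/
def numDistinctParts {n : ℕ} (p : n.Partition) : ℕ := p.parts.toFinset.card

/-- `D(n)`: the partitions of `n` into distinct parts. -/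
def D (n : ℕ) : Finset (n.Partition) := Finset.univ.filter fun p => p.parts.Nodup

/-- The finite sets of positive integers with sum `n`. -/
def distinctSets (n : ℕ) : Finset (Finset ℕ) :=
  (Icc 1 n).powerset.filter fun S => ∑ x ∈ S, x = n

theorem mem_distinctSets {n : ℕ} {S : Finset ℕ} :
    S ∈ distinctSets n ↔ 0 ∉ S ∧ ∑ x ∈ S, x = n := by
  simp only [distinctSets, mem_filter, mem_powerset]
  refine and_congr_left fun h => ⟨fun hS h0 => ?_, fun h0 x hx => ?_⟩
  · simpa using hS h0
  · have h1 : x ≤ ∑ y ∈ S, y := single_le_sum (f := fun y => y) (fun _ _ => Nat.zero_le _) hx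
    have h2 : x ≠ 0 := fun h => h0 (h ▸ hx)
    rw [mem_Icc]
    omega

/-- The nonempty members of `distinctSets n` whose elements differ by less than `k`. -/
noncomputable def narrowSets (k n : ℕ) : Finset (Finset ℕ) :=
  (distinctSets n).filter fun S => S.Nonempty ∧ ∀ x ∈ S, ∀ y ∈ S, x < y + k

theorem mem_narrowSets {k n : ℕ} {S : Finset ℕ} :
    S ∈ narrowSets k n ↔
      (0 ∉ S ∧ ∑ x ∈ S, x = n) ∧ S.Nonempty ∧ ∀ x ∈ S, ∀ y ∈ S, x < y + k := by
  rw [narrowSets, mem_filter, mem_distinctSets]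

theorem sup_id_eq_of_mem {S : Finset ℕ} {m : ℕ} (hm : m ∈ S) (h : ∀ x ∈ S, x ≤ m) :
    S.sup id = m :=
  le_antisymm (Finset.sup_le h) (le_sup (f := id) hm)

theorem sInf_eq_of_mem {S : Finset ℕ} {m : ℕ} (hm : m ∈ S) (h : ∀ x ∈ S, m ≤ x) :
    sInf (S : Set ℕ) = m :=
  le_antisymm (Nat.sInf_le hm) (h _ (Nat.sInf_mem (s := (S : Set ℕ)) ⟨m, hm⟩))

theorem sup_id_mem {S : Finset ℕ} (hS : S.Nonempty) : S.sup id ∈ S := by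
  obtain ⟨m, hm, h⟩ := exists_mem_eq_sup S hS id
  rw [h]
  exact hm

theorem sInf_coe_mem {S : Finset ℕ} (hS : S.Nonempty) : sInf (S : Set ℕ) ∈ S :=
  Nat.sInf_mem (s := (S : Set ℕ)) hS

/-- Moving the largest element down by `k` is a bijection onto the narrow sets of smaller sum. -/
theorem sum_narrowSets_shift (k n : ℕ) :
    ∑ S ∈ (narrowSets k (n + k)).filter (fun S => ∃ x ∈ S, k < x), (-1 : ℂ) ^ #S =
      ∑ S ∈ narrowSets k n, (-1 : ℂ) ^ #S := by
  have down : ∀ S ∈ (narrowSets k (n + k)).filter (fun S => ∃ x ∈ S, k < x),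
      k < S.sup id ∧ S.sup id ∈ S ∧ S.sup id - k ∉ S.erase (S.sup id) := by
    intro S hS
    obtain ⟨hN, x, hx, hkx⟩ := mem_filter.1 hS
    obtain ⟨-, hne, hw⟩ := mem_narrowSets.1 hN
    have hk : k < S.sup id := hkx.trans_le (le_sup (f := id) hx)
    refine ⟨hk, sup_id_mem hne, fun h => ?_⟩
    have := hw _ (sup_id_mem hne) _ (mem_of_mem_erase h)
    omega
  have up : ∀ T ∈ narrowSets k n,
      sInf (T : Set ℕ) ∈ T ∧ sInf (T : Set ℕ) + k ∉ T.erase (sInf (T : Set ℕ)) := by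
    intro T hT
    obtain ⟨-, hne, hw⟩ := mem_narrowSets.1 hT
    refine ⟨sInf_coe_mem hne, fun h => ?_⟩
    have := hw _ (mem_of_mem_erase h) _ (sInf_coe_mem hne)
    omega
  refine sum_bij' (fun S _ => insert (S.sup id - k) (S.erase (S.sup id)))
    (fun T _ => insert (sInf (T : Set ℕ) + k) (T.erase (sInf (T : Set ℕ)))) ?_ ?_ ?_ ?_ ?_
  · intro S hS
    obtain ⟨hk, hm, hn⟩ := down S hS
    obtain ⟨⟨h0, hsum⟩, hne, hw⟩ := mem_narrowSets.1 (mem_filter.1 hS).1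
    have hle : ∀ x ∈ S, x ≤ S.sup id := fun x hx => le_sup (f := id) hx
    generalize S.sup id = m at *
    refine mem_narrowSets.2 ⟨⟨?_, ?_⟩, insert_nonempty _ _, ?_⟩
    · simp only [mem_insert, mem_erase, not_or]
      exact ⟨by omega, fun h => h0 h.2⟩
    · rw [sum_insert hn]
      have := add_sum_erase S (fun x => x) hm
      omega
    · simp only [mem_insert, mem_erase]
      rintro x (rfl | ⟨hx, hxS⟩) y (rfl | ⟨hy, hyS⟩)
      · have := hw m hm m hm
        omega
      · have := hw m hm y hyS
        omega
      · have := hle x hxS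
        omega
      · exact hw x hxS y hyS
  · intro T hT
    obtain ⟨hm, hn⟩ := up T hT
    obtain ⟨⟨h0, hsum⟩, hne, hw⟩ := mem_narrowSets.1 hT
    have hle : ∀ x ∈ T, sInf (T : Set ℕ) ≤ x := fun x hx => Nat.sInf_le hx
    generalize sInf (T : Set ℕ) = m at *
    have hm0 : m ≠ 0 := fun h => h0 (h ▸ hm)
    refine mem_filter.2 ⟨mem_narrowSets.2 ⟨⟨?_, ?_⟩, insert_nonempty _ _, ?_⟩, m + k,
      mem_insert_self _ _, by omega⟩
    · simp only [mem_insert, mem_erase, not_or]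
      exact ⟨by omega, fun h => h0 h.2⟩
    · rw [sum_insert hn]
      have := add_sum_erase T (fun x => x) hm
      omega
    · simp only [mem_insert, mem_erase]
      rintro x (rfl | ⟨hx, hxS⟩) y (rfl | ⟨hy, hyS⟩)
      · have := hw m hm m hm
        omega
      · have := hle y hyS
        omega
      · have := hw x hxS m hm
        omega
      · exact hw x hxS y hyS
  · intro S hS
    obtain ⟨hk, hm, hn⟩ := down S hS
    obtain ⟨-, hne, hw⟩ := mem_narrowSets.1 (mem_filter.1 hS).1
    have hinf : sInf ((insert (S.sup id - k) (S.erase (S.sup id)) : Finset ℕ) : Set ℕ) =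
        S.sup id - k := by
      refine sInf_eq_of_mem (mem_insert_self _ _) fun x hx => ?_
      obtain rfl | hx := mem_insert.1 hx
      · exact le_rfl
      · have := hw _ hm x (mem_of_mem_erase hx)
        omega
    simp only [hinf, erase_insert hn]
    rw [Nat.sub_add_cancel hk.le, insert_erase hm]
  · intro T hT
    obtain ⟨hm, hn⟩ := up T hT
    obtain ⟨-, hne, hw⟩ := mem_narrowSets.1 hT
    have hsup : (insert (sInf (T : Set ℕ) + k) (T.erase (sInf (T : Set ℕ)))).sup id =
        sInf (T : Set ℕ) + k := by
      refine sup_id_eq_of_mem (mem_insert_self _ _) fun x hx => ?_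
      obtain rfl | hx := mem_insert.1 hx
      · exact le_rfl
      · exact (hw x (mem_of_mem_erase hx) _ hm).le
    simp only [hsup, erase_insert hn]
    rw [Nat.add_sub_cancel, insert_erase hm]
  · intro S hS
    obtain ⟨-, hm, hn⟩ := down S hS
    rw [card_insert_of_notMem hn, card_erase_add_one hm]

/-- Removing the largest element `k` is a bijection onto the sets with all elements below `k`. -/
theorem sum_narrowSets_max_eq {k : ℕ} (hk : 0 < k) (n : ℕ) :
    ∑ S ∈ (narrowSets k (n + k)).filter (fun S => k ∈ S ∧ ∀ x ∈ S, x ≤ k), (-1 : ℂ) ^ #S =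
      -∑ S ∈ (distinctSets n).filter (fun S => ∀ x ∈ S, x < k), (-1 : ℂ) ^ #S := by
  rw [← sum_neg_distrib]
  refine sum_bij' (fun S _ => S.erase k) (fun T _ => insert k T) ?_ ?_ ?_ ?_ ?_
  · intro S hS
    obtain ⟨hN, hm, hle⟩ := mem_filter.1 hS
    obtain ⟨⟨h0, hsum⟩, -, -⟩ := mem_narrowSets.1 hN
    refine mem_filter.2 ⟨mem_distinctSets.2 ⟨fun h => h0 (mem_of_mem_erase h), ?_⟩, ?_⟩
    · have := add_sum_erase S (fun x => x) hm
      omega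
    · intro x hx
      exact lt_of_le_of_ne (hle x (mem_of_mem_erase hx)) (ne_of_mem_erase hx)
  · intro T hT
    obtain ⟨hD, hlt⟩ := mem_filter.1 hT
    obtain ⟨h0, hsum⟩ := mem_distinctSets.1 hD
    have hle : ∀ x ∈ insert k T, x ≤ k := by
      simpa using fun x hx => (hlt x hx).le
    have h0' : 0 ∉ insert k T := by
      simp only [mem_insert, not_or]
      exact ⟨hk.ne, h0⟩
    refine mem_filter.2 ⟨mem_narrowSets.2 ⟨⟨h0', ?_⟩, insert_nonempty _ _, ?_⟩,
      mem_insert_self _ _, hle⟩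
    · rw [sum_insert fun h => (hlt k h).false, hsum, add_comm]
    · intro x hx y hy
      have h1 := hle x hx
      have h2 : y ≠ 0 := fun h => h0' (h ▸ hy)
      omega
  · intro S hS
    exact insert_erase (mem_filter.1 hS).2.1
  · intro T hT
    exact erase_insert fun h => ((mem_filter.1 hT).2 k h).false
  · intro S hS
    rw [← card_erase_add_one (mem_filter.1 hS).2.1, pow_succ]
    ring

/-- The signed count of the narrow sets with largest element at least `k`. -/
noncomputable def signedCount (k n : ℕ) : ℂ :=
  ∑ S ∈ (narrowSets k n).filter (fun S => ∃ x ∈ S, k ≤ x), (-1 : ℂ) ^ #S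

theorem sum_narrowSets_eq (k n : ℕ) :
    ∑ S ∈ narrowSets k n, (-1 : ℂ) ^ #S =
      signedCount k n +
        ∑ S ∈ (narrowSets k n).filter (fun S => ∀ x ∈ S, x < k), (-1 : ℂ) ^ #S := by
  rw [signedCount, ← sum_filter_add_sum_filter_not _ (fun S => ∃ x ∈ S, k ≤ x)]
  simp only [not_exists, not_and, not_le]

theorem sum_distinctSets_lt (k n : ℕ) :
    ∑ S ∈ (distinctSets n).filter (fun S => ∀ x ∈ S, x < k), (-1 : ℂ) ^ #S =
      (∑ S ∈ (narrowSets k n).filter (fun S => ∀ x ∈ S, x < k), (-1 : ℂ) ^ #S) +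
        if n = 0 then 1 else 0 := by
  rw [← sum_filter_add_sum_filter_not _ (fun S => S.Nonempty)]
  congr 1
  · refine sum_congr ?_ fun _ _ => rfl
    ext S
    simp only [mem_filter, mem_narrowSets, mem_distinctSets]
    refine ⟨fun ⟨⟨h, hlt⟩, hne⟩ => ⟨⟨h, hne, fun x hx y hy => ?_⟩, hlt⟩,
      fun ⟨⟨h, hne, _⟩, hlt⟩ => ⟨⟨h, hlt⟩, hne⟩⟩
    have := hlt x hx
    omega
  · split_ifs with hn
    · rw [sum_eq_single ∅]
      · simp
      · intro S hS hne
        exact absurd (nonempty_iff_ne_empty.2 hne) (mem_filter.1 hS).2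
      · intro h
        exact absurd (by simp [mem_distinctSets, hn]) h
    · refine sum_eq_zero fun S hS => absurd ?_ hn
      obtain ⟨h, hne⟩ := mem_filter.1 hS
      rw [not_nonempty_iff_eq_empty] at hne
      have := (mem_distinctSets.1 (mem_filter.1 h).1).2
      simpa [hne] using this.symm

theorem signedCount_add {k : ℕ} (hk : 0 < k) (n : ℕ) :
    signedCount k (n + k) = signedCount k n - if n = 0 then 1 else 0 := by
  have h1 : signedCount k (n + k) =
      (∑ S ∈ (narrowSets k (n + k)).filter (fun S => ∃ x ∈ S, k < x), (-1 : ℂ) ^ #S) +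
      ∑ S ∈ (narrowSets k (n + k)).filter (fun S => k ∈ S ∧ ∀ x ∈ S, x ≤ k), (-1 : ℂ) ^ #S := by
    rw [signedCount, ← sum_filter_add_sum_filter_not _ (fun S => ∃ x ∈ S, k < x),
      filter_filter, filter_filter]
    congr 2
    · refine filter_congr fun S _ => ⟨fun h => h.2, fun ⟨x, hx, h⟩ => ⟨⟨x, hx, h.le⟩, x, hx, h⟩⟩
    · refine filter_congr fun S _ => ?_
      simp only [not_exists, not_and, not_lt]
      refine ⟨fun ⟨⟨x, hx, hkx⟩, h⟩ => ⟨?_, h⟩, fun ⟨hm, h⟩ => ⟨⟨k, hm, le_rfl⟩, h⟩⟩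
      rwa [le_antisymm hkx (h x hx)]
  rw [h1, sum_narrowSets_shift, sum_narrowSets_max_eq hk, sum_narrowSets_eq, sum_distinctSets_lt]
  ring

theorem signedCount_of_lt {k n : ℕ} (h : n < k) : signedCount k n = 0 := by
  rw [signedCount, filter_false_of_mem, sum_empty]
  rintro S hS ⟨x, hx, hkx⟩
  have h1 : x ≤ ∑ y ∈ S, y := single_le_sum (f := fun y => y) (fun _ _ => Nat.zero_le _) hx
  have h2 := (mem_narrowSets.1 hS).1.2
  omega

theorem signedCount_eq {k : ℕ} (hk : 0 < k) {n : ℕ} (hn : 0 < n) :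
    signedCount k n = if k ∣ n then -1 else 0 := by
  induction n using Nat.strong_induction_on with
  | _ n ih =>
    obtain h | h := lt_or_ge n k
    · rw [signedCount_of_lt h, if_neg (Nat.not_dvd_of_pos_of_lt hn h)]
    · obtain ⟨m, rfl⟩ := Nat.exists_eq_add_of_le' h
      rw [signedCount_add hk]
      obtain rfl | hm := Nat.eq_zero_or_pos m
      · simp [signedCount_of_lt hk]
      · rw [ih m (by omega) hm, if_neg hm.ne', sub_zero]
        simp

theorem sum_D_eq_sum_distinctSets (n : ℕ) (g : Finset ℕ → ℂ) :
    ∑ p ∈ D n, g p.parts.toFinset = ∑ S ∈ distinctSets n, g S := by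
  refine sum_bij (fun p _ => p.parts.toFinset) ?_ ?_ ?_ fun _ _ => rfl
  · intro p hp
    have hnd : p.parts.Nodup := (mem_filter.1 hp).2
    refine mem_distinctSets.2 ⟨fun h => ?_, ?_⟩
    · exact (p.parts_pos (Multiset.mem_toFinset.1 h)).false
    · rw [sum_eq_multiset_sum, Multiset.map_id', Multiset.toFinset_val, hnd.dedup, p.parts_sum]
  · intro p hp q hq h
    refine Nat.Partition.ext ?_
    exact Multiset.Nodup.toFinset_inj (mem_filter.1 hp).2 (mem_filter.1 hq).2 h
  · intro S hS
    obtain ⟨h0, hsum⟩ := mem_distinctSets.1 hS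
    refine ⟨⟨S.val, fun {i} hi => Nat.pos_of_ne_zero fun h => h0 (h ▸ hi), ?_⟩, ?_, ?_⟩
    · rw [← hsum, sum_eq_multiset_sum, Multiset.map_id']
    · exact mem_filter.2 ⟨mem_univ _, S.nodup⟩
    · exact S.val_toFinset

/-- The window of exponents attached to a set expands as a sum over all exponents up to `n`. -/
theorem sum_Icc_window {n : ℕ} (a : ℂ) {S : Finset ℕ} (hn : 0 < n) (hS : S ∈ distinctSets n) :
    ∑ j ∈ Icc 1 (sInf (S : Set ℕ)), a ^ (S.sup id - sInf (S : Set ℕ) + j) =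
      ∑ k ∈ Icc 1 n,
        if S ∈ (narrowSets k n).filter (fun S => ∃ x ∈ S, k ≤ x) then a ^ k else 0 := by
  obtain ⟨h0, hsum⟩ := mem_distinctSets.1 hS
  have hne : S.Nonempty := by
    rw [nonempty_iff_ne_empty]
    rintro rfl
    simp at hsum
    omega
  have hsup := sup_id_mem hne
  have hinf := sInf_coe_mem hne
  have hle : ∀ x ∈ S, x ≤ S.sup id := fun x hx => le_sup (f := id) hx
  have hge : ∀ x ∈ S, sInf (S : Set ℕ) ≤ x := fun x hx => Nat.sInf_le hx
  have hn' : S.sup id ≤ n := by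
    rw [← hsum]
    exact single_le_sum (f := fun y => y) (fun _ _ => Nat.zero_le _) hsup
  have key : ∀ k, S ∈ (narrowSets k n).filter (fun S => ∃ x ∈ S, k ≤ x) ↔
      S.sup id < sInf (S : Set ℕ) + k ∧ k ≤ S.sup id := by
    intro k
    rw [mem_filter, mem_narrowSets]
    constructor
    · rintro ⟨⟨-, -, hw⟩, x, hx, hkx⟩
      exact ⟨hw _ hsup _ hinf, hkx.trans (hle x hx)⟩
    · rintro ⟨h1, h2⟩
      refine ⟨⟨⟨h0, hsum⟩, hne, fun x hx y hy => ?_⟩, _, hsup, h2⟩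
      have := hle x hx
      have := hge y hy
      omega
  simp only [key]
  rw [← sum_filter]
  have hms := hle _ hinf
  generalize S.sup id = m at *
  generalize sInf (S : Set ℕ) = s at *
  refine sum_bij' (fun j _ => m - s + j) (fun k _ => k - (m - s)) ?_ ?_ ?_ ?_ ?_ <;>
    simp only [mem_filter, mem_Icc] <;> intros <;> first | omega | trivial

theorem sum_distinct_eq_sum_divisors {n : ℕ} (hn : 0 < n) (a : ℂ) :
    ∑ p ∈ D n, (-1 : ℂ) ^ (numParts p - 1) *
        ∑ j ∈ Finset.Icc 1 (smallestPart p), a ^ (largestPart p - smallestPart p + j)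
      = ∑ d ∈ n.divisors, a ^ d := by
  have h1 : ∀ p ∈ D n, (-1 : ℂ) ^ (numParts p - 1) *
        ∑ j ∈ Finset.Icc 1 (smallestPart p), a ^ (largestPart p - smallestPart p + j) =
      (fun S : Finset ℕ => (-1 : ℂ) ^ (#S - 1) *
        ∑ j ∈ Icc 1 (sInf (S : Set ℕ)), a ^ (S.sup id - sInf (S : Set ℕ) + j))
        p.parts.toFinset := by
    intro p hp
    have hs : smallestPart p = sInf (p.parts.toFinset : Set ℕ) := by
      refine congrArg sInf (Set.ext fun x => ?_)
      simp
    simp only [hs, largestPart, numParts, Multiset.toFinset_card_of_nodup (mem_filter.1 hp).2]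
  rw [sum_congr rfl h1, sum_D_eq_sum_distinctSets n fun S : Finset ℕ => (-1 : ℂ) ^ (#S - 1) *
    ∑ j ∈ Icc 1 (sInf (S : Set ℕ)), a ^ (S.sup id - sInf (S : Set ℕ) + j)]
  have h2 : ∀ S ∈ distinctSets n, (-1 : ℂ) ^ (#S - 1) *
        ∑ j ∈ Icc 1 (sInf (S : Set ℕ)), a ^ (S.sup id - sInf (S : Set ℕ) + j) =
      ∑ k ∈ Icc 1 n, -a ^ k *
        if S ∈ (narrowSets k n).filter (fun S => ∃ x ∈ S, k ≤ x) then (-1 : ℂ) ^ #S else 0 := by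
    intro S hS
    rw [sum_Icc_window a hn hS, mul_sum]
    refine sum_congr rfl fun k _ => ?_
    split_ifs with h
    · have hc : 0 < #S := card_pos.2 (mem_narrowSets.1 (mem_filter.1 h).1).2.1
      obtain ⟨c, hc'⟩ := Nat.exists_eq_add_of_le' hc
      rw [hc', Nat.add_sub_cancel, pow_succ]
      ring
    · simp
  rw [sum_congr rfl h2, sum_comm]
  have h3 : ∀ k ∈ Icc 1 n, ∑ S ∈ distinctSets n, (-a ^ k *
        if S ∈ (narrowSets k n).filter (fun S => ∃ x ∈ S, k ≤ x) then (-1 : ℂ) ^ #S else 0) =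
      if k ∣ n then a ^ k else 0 := by
    intro k hk
    have hsub : (narrowSets k n).filter (fun S => ∃ x ∈ S, k ≤ x) ⊆ distinctSets n :=
      (filter_subset _ _).trans (filter_subset _ _)
    rw [← mul_sum, ← sum_filter, filter_mem_eq_inter, inter_eq_right.2 hsub, ← signedCount,
      signedCount_eq (mem_Icc.1 hk).1 hn]
    split_ifs <;> simp
  rw [sum_congr rfl h3, ← sum_filter]
  refine sum_congr ?_ fun _ _ => rfl
  ext d
  simp only [mem_filter, mem_Icc, Nat.mem_divisors]
  exact ⟨fun h => ⟨h.2, hn.ne'⟩,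
    fun h => ⟨⟨Nat.pos_of_dvd_of_pos h.1 hn, Nat.le_of_dvd hn h.1⟩, h.1⟩⟩

theorem sum_Icc_pow_add {a : ℂ} (ha : a ≠ 1) (m s : ℕ) :
    ∑ j ∈ Icc 1 s, a ^ (m + j) = a ^ (m + 1) * ((a ^ s - 1) / (a - 1)) := by
  rw [← geom_sum_eq ha, mul_sum, ← Ico_add_one_right_eq_Icc, sum_Ico_eq_sum_range]
  refine sum_congr (by simp) fun j _ => ?_
  rw [← pow_add, add_assoc]

theorem stmt16 (n : ℕ) (hn : 0 < n) (a : ℂ) :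
    (a ≠ 1 →
      ∑ p ∈ D n, (-1 : ℂ) ^ (numParts p - 1) *
          a ^ (largestPart p - smallestPart p + 1) *
          ((a ^ smallestPart p - 1) / (a - 1))
        = ∑ d ∈ n.divisors, a ^ d) ∧
    (∑ p ∈ D n, (-1 : ℂ) ^ (numParts p - 1) *
        ∑ j ∈ Finset.Icc 1 (smallestPart p), a ^ (largestPart p - smallestPart p + j)
      = ∑ d ∈ n.divisors, a ^ d) := by
  refine ⟨fun ha => ?_, sum_distinct_eq_sum_divisors hn a⟩
  rw [← sum_distinct_eq_sum_divisors hn a]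
  refine sum_congr rfl fun p _ => ?_
  rw [sum_Icc_pow_add ha, mul_assoc]
end

section
/- For every positive integer n, one has ∑_{π ∈ P(n)} (-1)^{ℓ(π)-1} 2^{ν_d(π)-1} = ∑_{π ∈ D(n), s(π) odd} (-1)^{#(π)-1}, where the right-hand sum runs over partitions of n into distinct parts whose smallest part is odd. -/
open Finset

open scoped Classical

namespace PartitionSeries

open PowerSeries

open scoped PowerSeries.WithPiTopology

/-- The geometric series `∑ X ^ (i * j)`, the inverse of `1 - X ^ i` for positive `i`. -/
noncomputable def geom (i : ℕ) : ℤ⟦X⟧ := ∑' j : ℕ, X ^ (i * j)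

lemma summable_X_pow_mul {i : ℕ} (hi : 0 < i) :
    Summable fun j : ℕ => (X : ℤ⟦X⟧) ^ (i * j) := by
  simp_rw [pow_mul]
  exact WithPiTopology.summable_pow_of_constantCoeff_eq_zero (by simp [hi.ne'])

lemma one_sub_mul_geom {i : ℕ} (hi : 0 < i) : (1 - X ^ i) * geom i = 1 := by
  simp_rw [geom, pow_mul]
  exact WithPiTopology.one_sub_mul_tsum_pow_of_constantCoeff_eq_zero (by simp [hi.ne'])

lemma geom_eq_one_add {i : ℕ} (hi : 0 < i) :
    geom i = 1 + ∑' j : ℕ, (X : ℤ⟦X⟧) ^ (i * (j + 1)) := by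
  rw [geom, (summable_X_pow_mul hi).tsum_eq_zero_add]
  simp

/-- If no part larger than `M` contributes, the partition generating function is a finite
product. -/
lemma genFun_eq_prod_range (f : ℕ → ℕ → ℤ) (M : ℕ) (hf : ∀ i j, M < i → f i j = 0) :
    Nat.Partition.genFun f =
      ∏ i ∈ range M, (1 + ∑' j, f (i + 1) (j + 1) • (X : ℤ⟦X⟧) ^ ((i + 1) * (j + 1))) := by
  refine (Nat.Partition.hasProd_genFun f).unique (hasProd_prod_of_ne_finset_one fun i hi => ?_)
  have hi' : M < i + 1 := by simpa [Nat.lt_succ_iff] using hi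
  refine (congrArg (1 + ·) ((tsum_congr fun j => ?_).trans tsum_zero)).trans (add_zero 1)
  rw [hf _ _ hi']
  exact zero_smul ℤ _

/-! ### The truncated `q`-binomial series -/

/-- The coefficient `(a; X)_m / (X; X)_m` of the `q`-binomial series. -/
noncomputable def binomCoeff (a : ℤ⟦X⟧) (m : ℕ) : ℤ⟦X⟧ :=
  ∏ i ∈ range m, ((1 - a * X ^ i) * geom (i + 1))

/-- The `q`-binomial series at `z`, truncated to its first `N` terms. -/
noncomputable def binomSeries (a : ℤ⟦X⟧) (N : ℕ) (z : ℤ⟦X⟧) : ℤ⟦X⟧ :=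
  ∑ m ∈ range N, binomCoeff a m * z ^ m

lemma one_sub_mul_binomCoeff_succ (a : ℤ⟦X⟧) (m : ℕ) :
    (1 - X ^ (m + 1)) * binomCoeff a (m + 1) = (1 - a * X ^ m) * binomCoeff a m := by
  rw [binomCoeff, prod_range_succ, ← binomCoeff]
  linear_combination (1 - a * X ^ m) * binomCoeff a m * one_sub_mul_geom m.add_one_pos

lemma binomSeries_functional_equation (a z : ℤ⟦X⟧) (N : ℕ) :
    (1 - z) * binomSeries a N z - (1 - a * z) * binomSeries a N (X * z) =
      -((1 - X ^ N) * binomCoeff a N * z ^ N) := by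
  induction N with
  | zero => simp [binomSeries]
  | succ N ih =>
    rw [one_sub_mul_binomCoeff_succ]
    simp only [binomSeries, sum_range_succ] at ih ⊢
    rw [mul_pow]
    linear_combination ih

lemma X_pow_dvd_binomSeries_step (a : ℤ⟦X⟧) (N k : ℕ) :
    X ^ N ∣ (1 + X ^ (k + 1)) * binomSeries a N (-X ^ (k + 1)) -
      (1 + a * X ^ (k + 1)) * binomSeries a N (-X ^ (k + 2)) := by
  have h := binomSeries_functional_equation a (-X ^ (k + 1)) N
  have hX : (X : ℤ⟦X⟧) * -X ^ (k + 1) = -X ^ (k + 2) := by ring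
  rw [hX] at h
  have h2 : (1 + X ^ (k + 1)) * binomSeries a N (-X ^ (k + 1)) -
      (1 + a * X ^ (k + 1)) * binomSeries a N (-X ^ (k + 2)) =
      X ^ N * -((1 - X ^ N) * binomCoeff a N * (-X ^ k) ^ N) := by
    have h3 : (-X ^ (k + 1) : ℤ⟦X⟧) ^ N = X ^ N * (-X ^ k) ^ N := by
      rw [← mul_pow]; ring
    rw [h3] at h
    linear_combination h
  exact h2 ▸ dvd_mul_right _ _

lemma X_pow_dvd_prod_mul_binomSeries_sub (a : ℤ⟦X⟧) (N K : ℕ) :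
    X ^ N ∣ (∏ k ∈ range K, (1 + X ^ (k + 1))) * binomSeries a N (-X) -
      (∏ k ∈ range K, (1 + a * X ^ (k + 1))) * binomSeries a N (-X ^ (K + 1)) := by
  induction K with
  | zero => simp
  | succ K ih =>
    rw [prod_range_succ, prod_range_succ]
    obtain ⟨c, hc⟩ := ih
    obtain ⟨d, hd⟩ := X_pow_dvd_binomSeries_step a N K
    refine ⟨(1 + X ^ (K + 1)) * c + (∏ k ∈ range K, (1 + a * X ^ (k + 1))) * d, ?_⟩
    linear_combination (1 + X ^ (K + 1)) * hc + (∏ k ∈ range K, (1 + a * X ^ (k + 1))) * hd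

lemma X_pow_dvd_binomSeries_sub_one (a : ℤ⟦X⟧) (N : ℕ) :
    X ^ (N + 1) ∣ binomSeries a (N + 1) (-X ^ (N + 1)) - 1 := by
  rw [binomSeries, sum_range_succ']
  simp only [binomCoeff, range_zero, prod_empty, pow_zero, mul_one, add_sub_cancel_right]
  refine dvd_sum fun m _ => Dvd.dvd.mul_left ?_ _
  rw [pow_succ]
  exact Dvd.dvd.mul_left (by simp) _

lemma X_pow_dvd_prod_mul_binomSeries_sub_prod (a : ℤ⟦X⟧) (N : ℕ) :
    X ^ (N + 1) ∣ (∏ k ∈ range N, (1 + X ^ (k + 1))) * binomSeries a (N + 1) (-X) -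
      ∏ k ∈ range N, (1 + a * X ^ (k + 1)) := by
  obtain ⟨c, hc⟩ := X_pow_dvd_prod_mul_binomSeries_sub a (N + 1) N
  obtain ⟨d, hd⟩ := X_pow_dvd_binomSeries_sub_one a N
  refine ⟨c + (∏ k ∈ range N, (1 + a * X ^ (k + 1))) * d, ?_⟩
  linear_combination hc + (∏ k ∈ range N, (1 + a * X ^ (k + 1))) * hd

/-- The `q`-binomial theorem at `a = -1` and Euler's identity at `a = 0` express the same
quotient of infinite products. -/
lemma X_pow_dvd_binomSeries_neg_one_sub (N : ℕ) :
    X ^ (N + 1) ∣ binomSeries (-1) (N + 1) (-X) -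
      (∏ k ∈ range N, (1 - X ^ (k + 1))) * binomSeries 0 (N + 1) (-X) := by
  have hu : IsUnit (∏ k ∈ range N, (1 + X ^ (k + 1)) : ℤ⟦X⟧) := by
    rw [isUnit_iff_constantCoeff]
    simp
  rw [← hu.dvd_mul_left]
  obtain ⟨c, hc⟩ := X_pow_dvd_prod_mul_binomSeries_sub_prod (-1) N
  obtain ⟨d, hd⟩ := X_pow_dvd_prod_mul_binomSeries_sub_prod 0 N
  have hprod : ∏ k ∈ range N, (1 + -1 * X ^ (k + 1) : ℤ⟦X⟧) =
      ∏ k ∈ range N, (1 - X ^ (k + 1)) := by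
    simp [sub_eq_add_neg]
  rw [hprod] at hc
  simp only [zero_mul, add_zero, prod_const_one] at hd
  refine ⟨c - (∏ k ∈ range N, (1 - X ^ (k + 1))) * d, ?_⟩
  linear_combination hc - (∏ k ∈ range N, (1 - X ^ (k + 1))) * hd

/-! ### Partitions weighted by `2 ^ ν_d` and the largest part -/

/-- The generating function of partitions with parts at most `M`, weighted by
`2 ^ ν_d`. -/
noncomputable def boundedSeries (M : ℕ) : ℤ⟦X⟧ :=
  ∏ i ∈ range M, ((1 + X ^ (i + 1)) * geom (i + 1))

lemma largestPart_le_iff {n : ℕ} (p : n.Partition) (M : ℕ) :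
    largestPart p ≤ M ↔ ∀ i ∈ p.parts, i ≤ M := by
  simp [largestPart, Finset.sup_le_iff]

lemma coeff_boundedSeries (n M : ℕ) :
    coeff n (boundedSeries M) =
      ∑ p : n.Partition, if largestPart p ≤ M then 2 ^ numDistinctParts p else 0 := by
  have h : boundedSeries M = Nat.Partition.genFun fun i _ => if i ≤ M then (2 : ℤ) else 0 := by
    rw [genFun_eq_prod_range _ M (fun i _ hi => if_neg hi.not_ge), boundedSeries]
    refine prod_congr rfl fun i hi => ?_
    have hs : ∑' j : ℕ, (2 : ℤ) • (X : ℤ⟦X⟧) ^ ((i + 1) * (j + 1)) =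
        2 * ∑' j : ℕ, (X : ℤ⟦X⟧) ^ ((i + 1) * (j + 1)) := by
      rw [← ((summable_nat_add_iff 1).2 (summable_X_pow_mul i.add_one_pos)).tsum_mul_left]
      exact tsum_congr fun j => by simp [two_mul]
    have hi' : i + 1 ≤ M := by simpa using hi
    simp only [if_pos hi']
    rw [hs]
    linear_combination 2 * geom_eq_one_add i.add_one_pos - one_sub_mul_geom i.add_one_pos
  rw [h, Nat.Partition.coeff_genFun]
  refine sum_congr rfl fun p _ => ?_
  simp only [Finsupp.prod, Multiset.toFinsupp_support]
  split_ifs with hp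
  · rw [largestPart_le_iff] at hp
    rw [numDistinctParts, ← prod_const]
    exact prod_congr rfl fun i hi => if_pos (hp i (Multiset.mem_toFinset.1 hi))
  · rw [largestPart_le_iff] at hp
    push Not at hp
    obtain ⟨i, hi, hM⟩ := hp
    exact prod_eq_zero (Multiset.mem_toFinset.2 hi) (if_neg hM.not_ge)

lemma binomCoeff_neg_one_succ (m : ℕ) :
    binomCoeff (-1) (m + 1) = 2 * boundedSeries m * geom (m + 1) := by
  rw [binomCoeff, boundedSeries, prod_mul_distrib, prod_mul_distrib, prod_range_succ',
    prod_range_succ (fun i => geom (i + 1))]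
  simp only [neg_mul, one_mul, sub_neg_eq_add, pow_zero]
  ring

lemma boundedSeries_succ_sub (m : ℕ) :
    boundedSeries (m + 1) - boundedSeries m = X ^ (m + 1) * binomCoeff (-1) (m + 1) := by
  rw [binomCoeff_neg_one_succ, boundedSeries, prod_range_succ, ← boundedSeries]
  linear_combination boundedSeries m * one_sub_mul_geom m.add_one_pos

lemma exists_mem_parts {n : ℕ} (hn : 0 < n) (p : n.Partition) : ∃ i, i ∈ p.parts := by
  apply Multiset.exists_mem_of_ne_zero
  intro h
  have := p.parts_sum
  simp [h] at this
  omega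

lemma largestPart_pos {n : ℕ} (hn : 0 < n) (p : n.Partition) : 0 < largestPart p := by
  obtain ⟨i, hi⟩ := exists_mem_parts hn p
  exact (p.parts_pos hi).trans_le ((largestPart_le_iff p _).1 le_rfl i hi)

lemma largestPart_le {n : ℕ} (p : n.Partition) : largestPart p ≤ n :=
  (largestPart_le_iff p n).2 fun _ hi => p.le_of_mem_parts hi

lemma sum_range_ite_eq_add_one {n k : ℕ} (hk : 0 < k) (hkn : k ≤ n) (c : ℤ) :
    ∑ m ∈ range n, (-1 : ℤ) ^ (m + 1) * (if k = m + 1 then c else 0) = (-1) ^ k * c := by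
  obtain ⟨k, rfl⟩ := Nat.exists_eq_add_one_of_ne_zero hk.ne'
  rw [sum_eq_single_of_mem k (by simpa using hkn)]
  · simp
  · intro b _ hb
    simp [Ne.symm hb]

lemma coeff_binomSeries_neg_one {n : ℕ} (hn : 0 < n) :
    coeff n (binomSeries (-1) (n + 1) (-X)) =
      ∑ p : n.Partition, (-1 : ℤ) ^ largestPart p * 2 ^ numDistinctParts p := by
  have h : binomSeries (-1) (n + 1) (-X) =
      ∑ m ∈ range n, C ((-1 : ℤ) ^ (m + 1)) * (boundedSeries (m + 1) - boundedSeries m) + 1 := by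
    rw [binomSeries, sum_range_succ']
    congr 1
    · refine sum_congr rfl fun m _ => ?_
      rw [boundedSeries_succ_sub, neg_pow]
      simp only [map_pow, map_neg, map_one]
      ring
    · simp [binomCoeff]
  rw [h, map_add, coeff_one, if_neg hn.ne', add_zero, map_sum]
  simp only [coeff_C_mul, map_sub, coeff_boundedSeries, ← sum_sub_distrib, mul_sum]
  rw [sum_comm]
  refine sum_congr rfl fun p _ => ?_
  rw [← sum_range_ite_eq_add_one (largestPart_pos hn p) (largestPart_le p)]
  refine sum_congr rfl fun m _ => ?_
  congr 1
  split_ifs <;> omega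

/-! ### Distinct partitions weighted by `(-1) ^ #` and the smallest part -/

lemma lt_smallestPart_iff {n : ℕ} (hn : 0 < n) (p : n.Partition) (m : ℕ) :
    m < smallestPart p ↔ ∀ i ∈ p.parts, m < i := by
  constructor
  · intro h i hi
    exact h.trans_le (Nat.sInf_le hi)
  · intro h
    exact h _ (Nat.sInf_mem (s := {j | j ∈ p.parts}) (exists_mem_parts hn p))

lemma smallestPart_mem {n : ℕ} (hn : 0 < n) (p : n.Partition) : smallestPart p ∈ p.parts :=
  Nat.sInf_mem (s := {j | j ∈ p.parts}) (exists_mem_parts hn p)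

/-- The generating function of partitions into distinct parts in `(m, N]`, weighted by
`(-1) ^ #`. -/
noncomputable def distinctSeries (N m : ℕ) : ℤ⟦X⟧ := ∏ i ∈ Ico m N, (1 - X ^ (i + 1))

lemma coeff_distinctSeries {n : ℕ} (hn : 0 < n) (m : ℕ) :
    coeff n (distinctSeries n m) =
      ∑ p ∈ D n, if m < smallestPart p then (-1 : ℤ) ^ numParts p else 0 := by
  have h : distinctSeries n m =
      Nat.Partition.genFun fun i j => if (m < i ∧ i ≤ n) ∧ j = 1 then (-1 : ℤ) else 0 := by
    rw [genFun_eq_prod_range _ n (fun i _ hi => if_neg (by omega)), distinctSeries]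
    have hsub : Ico m n ⊆ range n := fun i hi => by simp at hi ⊢; omega
    rw [← prod_subset_one_on_sdiff hsub (f := fun i => (1 - X ^ (i + 1) : ℤ⟦X⟧)) ?_ ?_]
    · intro i hi
      have : ¬ m < i + 1 := by simp at hi; omega
      simp [this]
    · intro i hi
      have h1 : m < i + 1 ∧ i + 1 ≤ n := by simp at hi; omega
      rw [tsum_eq_single 0]
      · simp [h1, sub_eq_add_neg]
      · intro j hj
        simp [hj]
  rw [h, Nat.Partition.coeff_genFun, D, sum_filter]
  refine sum_congr rfl fun p _ => ?_
  simp only [Finsupp.prod, Multiset.toFinsupp_support, Multiset.toFinsupp_apply]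
  by_cases hd : p.parts.Nodup
  · rw [if_pos hd]
    split_ifs with hp
    · rw [lt_smallestPart_iff hn] at hp
      rw [numParts, ← Multiset.toFinset_card_of_nodup hd, ← prod_const]
      refine prod_congr rfl fun i hi => if_pos ?_
      have hi' := Multiset.mem_toFinset.1 hi
      exact ⟨⟨hp i hi', p.le_of_mem_parts hi'⟩, Multiset.count_eq_one_of_mem hd hi'⟩
    · rw [lt_smallestPart_iff hn] at hp
      push Not at hp
      obtain ⟨i, hi, hm⟩ := hp
      exact prod_eq_zero (Multiset.mem_toFinset.2 hi) (if_neg (by omega))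
  · rw [if_neg hd]
    rw [Multiset.nodup_iff_count_le_one] at hd
    push Not at hd
    obtain ⟨i, hi⟩ := hd
    have hmem : i ∈ p.parts.toFinset :=
      Multiset.mem_toFinset.2 (Multiset.count_pos.1 (zero_lt_one.trans hi))
    exact prod_eq_zero hmem (if_neg fun h => hi.ne' (by convert h.2))

lemma distinctSeries_eq_mul_binomCoeff {N m : ℕ} (hm : m ≤ N) :
    distinctSeries N m = distinctSeries N 0 * binomCoeff 0 m := by
  have h : (∏ i ∈ range m, (1 - X ^ (i + 1) : ℤ⟦X⟧)) * binomCoeff 0 m = 1 := by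
    rw [binomCoeff, ← prod_mul_distrib]
    exact prod_eq_one fun i _ => by simpa using one_sub_mul_geom i.add_one_pos
  have h2 : distinctSeries N 0 = (∏ i ∈ range m, (1 - X ^ (i + 1))) * distinctSeries N m := by
    rw [distinctSeries, distinctSeries, range_eq_Ico,
      prod_Ico_consecutive _ (Nat.zero_le m) hm]
  rw [h2]
  linear_combination -distinctSeries N m * h

lemma distinctSeries_sub_succ {N m : ℕ} (hm : m < N) :
    distinctSeries N m - distinctSeries N (m + 1) =
      -(X ^ (m + 1) * (distinctSeries N 0 * binomCoeff 0 (m + 1))) := by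
  rw [← distinctSeries_eq_mul_binomCoeff hm, distinctSeries, prod_eq_prod_Ico_succ_bot hm,
    ← distinctSeries]
  ring

lemma coeff_distinctSeries_mul_binomSeries {n : ℕ} (hn : 0 < n) :
    coeff n (distinctSeries n 0 * binomSeries 0 (n + 1) (-X)) =
      ∑ p ∈ D n, ((-1 : ℤ) ^ numParts p - (-1) ^ smallestPart p * (-1) ^ numParts p) := by
  have h : distinctSeries n 0 * binomSeries 0 (n + 1) (-X) = distinctSeries n 0 -
      ∑ m ∈ range n, C ((-1 : ℤ) ^ (m + 1)) *
        (distinctSeries n m - distinctSeries n (m + 1)) := by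
    have hs : ∑ m ∈ range n, C ((-1 : ℤ) ^ (m + 1)) *
        (distinctSeries n m - distinctSeries n (m + 1)) =
        -(distinctSeries n 0 * ∑ m ∈ range n, binomCoeff 0 (m + 1) * (-X) ^ (m + 1)) := by
      rw [mul_sum, ← sum_neg_distrib]
      refine sum_congr rfl fun m hm => ?_
      rw [distinctSeries_sub_succ (mem_range.1 hm), neg_pow X]
      simp only [map_pow, map_neg, map_one]
      ring
    rw [hs, binomSeries, sum_range_succ']
    simp [binomCoeff]
    ring
  rw [h, map_sub, map_sum]
  simp only [coeff_C_mul, map_sub, coeff_distinctSeries hn, ← sum_sub_distrib, mul_sum]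
  rw [sum_comm, ← sum_sub_distrib]
  refine sum_congr rfl fun p _ => ?_
  have hpos : 0 < smallestPart p := p.parts_pos (smallestPart_mem hn p)
  rw [if_pos hpos,
    ← sum_range_ite_eq_add_one hpos (p.le_of_mem_parts (smallestPart_mem hn p))]
  congr 1
  refine sum_congr rfl fun m _ => ?_
  congr 1
  split_ifs <;> omega

end PartitionSeries

open PartitionSeries

theorem stmt18 (n : ℕ) (hn : 0 < n) :
    ∑ p : n.Partition, (-1 : ℤ) ^ (largestPart p - 1) * 2 ^ (numDistinctParts p - 1)
      = ∑ p ∈ (D n).filter (fun p => Odd (smallestPart p)),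
          (-1 : ℤ) ^ (numParts p - 1) := by
  have key : PowerSeries.coeff n (binomSeries (-1) (n + 1) (-PowerSeries.X)) =
      PowerSeries.coeff n (distinctSeries n 0 * binomSeries 0 (n + 1) (-PowerSeries.X)) := by
    have h := PowerSeries.X_pow_dvd_iff.1 (X_pow_dvd_binomSeries_neg_one_sub n) n n.lt_succ_self
    rw [map_sub, sub_eq_zero] at h
    rw [h, distinctSeries, range_eq_Ico]
  rw [coeff_binomSeries_neg_one hn, coeff_distinctSeries_mul_binomSeries hn] at key
  have hl : ∑ p : n.Partition, (-1 : ℤ) ^ largestPart p * 2 ^ numDistinctParts p =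
      -2 * ∑ p : n.Partition, (-1 : ℤ) ^ (largestPart p - 1) * 2 ^ (numDistinctParts p - 1) := by
    rw [mul_sum]
    refine sum_congr rfl fun p _ => ?_
    obtain ⟨a, ha⟩ := Nat.exists_eq_add_one_of_ne_zero (largestPart_pos hn p).ne'
    have hν : numDistinctParts p ≠ 0 := by
      obtain ⟨i, hi⟩ := exists_mem_parts hn p
      exact card_ne_zero_of_mem (Multiset.mem_toFinset.2 hi)
    obtain ⟨b, hb⟩ := Nat.exists_eq_add_one_of_ne_zero hν
    rw [ha, hb, Nat.add_sub_cancel, Nat.add_sub_cancel]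
    ring
  have hr : ∑ p ∈ D n, ((-1 : ℤ) ^ numParts p - (-1) ^ smallestPart p * (-1) ^ numParts p) =
      -2 * ∑ p ∈ (D n).filter (fun p => Odd (smallestPart p)), (-1 : ℤ) ^ (numParts p - 1) := by
    rw [mul_sum, sum_filter]
    refine sum_congr rfl fun p _ => ?_
    split_ifs with ho
    · have hc : numParts p ≠ 0 := by
        obtain ⟨i, hi⟩ := exists_mem_parts hn p
        exact (Multiset.card_pos_iff_exists_mem.2 ⟨i, hi⟩).ne'
      obtain ⟨b, hb⟩ := Nat.exists_eq_add_one_of_ne_zero hc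
      rw [ho.neg_one_pow, hb, Nat.add_sub_cancel]
      ring
    · rw [(Nat.not_odd_iff_even.1 ho).neg_one_pow]
      ring
  rw [hl, hr] at key
  linarith
end

section
/- For every positive integer n and every complex number t with t ≠ 0, one has ∑_{π ∈ P(n), s(π) ≥ 2} t^{ℓ(π)+#(π)-2} (1 - 1/t)^{ν_d(π)-1} = ∑_{π ∈ P(n), ℓ(π) = 2} t^{#(π)} + ∑_{π ∈ P_1*(n), s(π) = 2, ℓ(π) ≥ 3} (-1)^{ℓ(π)} t^{#(π)} ν(ℓ(π) - 1). -/
open Finset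

open scoped Classical

/-- `P₁*(n)`: partitions of `n` in which every integer lying between the smallest
and the largest part also occurs as a part. -/
noncomputable def P1star (n : ℕ) : Finset (n.Partition) :=
  Finset.univ.filter fun p => ∀ j, smallestPart p ≤ j → j ≤ largestPart p → j ∈ p.parts

section TruncatedIdentity

variable {R : Type*} [CommRing R] (q t : R) (A : ℕ → R)

/-- A partial sum, over `N < B`, of a series of Rogers-Fine type; `A i` plays the role of the
inverse of `1 - t * q ^ i`. -/
def fineSum (k B : ℕ) : R :=
  ∑ N ∈ range B, (t * q ^ (k + 1)) ^ N * (∏ j ∈ range N, (1 - q ^ (j + 2))) *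
    ∏ j ∈ range (N + 1), A (k + 2 + j)

variable {q t A}

theorem fineSum_contiguous (hA : ∀ i, 1 ≤ i → (1 - t * q ^ i) * A i = 1) (k B : ℕ) :
    (1 - t * q ^ (k + 2)) * fineSum q t A k B + t * q ^ (k + 3) * fineSum q t A (k + 1) B =
      A (k + 1) * (1 - (t * q ^ (k + 1)) ^ B * (∏ j ∈ range B, (1 - q ^ (j + 2))) *
        ∏ j ∈ range B, A (k + 3 + j)) := by
  induction B with
  | zero => simp [fineSum]
  | succ B ih =>
    have h1 := hA (k + 1) (by omega)
    have h2 := hA (k + 2) (by omega)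
    have h3 := hA (k + 3 + B) (by omega)
    have hs (k : ℕ) : fineSum q t A k (B + 1) = fineSum q t A k B +
        (t * q ^ (k + 1)) ^ B * (∏ j ∈ range B, (1 - q ^ (j + 2))) *
          ∏ j ∈ range (B + 1), A (k + 2 + j) := by
      rw [fineSum, sum_range_succ, ← fineSum]
    have e1 : ∏ j ∈ range (B + 1), A (k + 2 + j) = A (k + 2) * ∏ j ∈ range B, A (k + 3 + j) := by
      rw [prod_range_succ', mul_comm]
      simp only [Nat.add_zero]
      congr 1
      exact prod_congr rfl fun j _ => by congr 1; omega
    have e2 : ∏ j ∈ range (B + 1), A (k + 1 + 2 + j) =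
        (∏ j ∈ range B, A (k + 3 + j)) * A (k + 3 + B) := prod_range_succ _ _
    rw [hs, hs, e1, e2, prod_range_succ (fun j => 1 - q ^ (j + 2))]
    generalize (∏ j ∈ range B, A (k + 3 + j)) = P at *
    generalize (∏ j ∈ range B, (1 - q ^ (j + 2))) = Q at *
    generalize A (k + 1) = a1 at *
    generalize A (k + 2) = a2 at *
    generalize A (k + 3 + B) = a3 at *
    have e4 : (t * q ^ (k + 1 + 1)) ^ B = (t * q ^ (k + 1)) ^ B * q ^ B := by
      rw [← mul_pow]; ring
    rw [e4, pow_succ (t * q ^ (k + 1))]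
    generalize hT : (t * q ^ (k + 1)) ^ B = T at *
    have h3' : (1 - t * q ^ (k + 1) * q ^ 2 * q ^ B) * a3 = 1 := by linear_combination h3
    rw [show q ^ (k + 3) = q ^ (k + 1) * q ^ 2 by ring, ← mul_assoc t] at ih ⊢
    rw [show q ^ (B + 2) = q ^ B * q ^ 2 by ring]
    generalize t * q ^ (k + 2) = u at *
    generalize t * q ^ (k + 1) = x at *
    linear_combination ih + T * Q * P * h2 - T * Q * P * h3' - T * Q * P * a3 * h1 +
      T * Q * P * a1 * h3'

theorem pow_dvd_fineSum_sub (hA : ∀ i, 1 ≤ i → (1 - t * q ^ i) * A i = 1) (B K : ℕ) :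
    q ^ B ∣ fineSum q t A 0 B -
      (∑ M ∈ range K, (∏ j ∈ range M, -(t * q ^ (j + 3) * A (j + 2))) * A (M + 2) * A (M + 1) +
        (∏ j ∈ range K, -(t * q ^ (j + 3) * A (j + 2))) * fineSum q t A K B) := by
  induction K with
  | zero => simp
  | succ K ih =>
    have h2 := hA (K + 2) (by omega)
    have hc := fineSum_contiguous hA K B
    rw [mul_pow, ← pow_mul] at hc
    have hd : q ^ B ∣ q ^ ((K + 1) * B) := pow_dvd_pow _ (by nlinarith)
    obtain ⟨c, hc'⟩ := hd
    rw [hc'] at hc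
    have hd2 : q ^ B ∣ (∏ j ∈ range K, -(t * q ^ (j + 3) * A (j + 2))) * A (K + 2) * A (K + 1) *
        (t ^ B * (q ^ B * c) * (∏ j ∈ range B, (1 - q ^ (j + 2))) *
          ∏ j ∈ range B, A (K + 3 + j)) :=
      ⟨(∏ j ∈ range K, -(t * q ^ (j + 3) * A (j + 2))) * A (K + 2) * A (K + 1) *
        (t ^ B * c * (∏ j ∈ range B, (1 - q ^ (j + 2))) * ∏ j ∈ range B, A (K + 3 + j)), by ring⟩
    have := dvd_sub ih hd2
    convert this using 1
    rw [sum_range_succ, prod_range_succ]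
    generalize (∏ j ∈ range K, -(t * q ^ (j + 3) * A (j + 2))) = P at *
    linear_combination P * A (K + 2) * hc - P * fineSum q t A K B * h2

theorem pow_dvd_fineSum_sub_sum (hA : ∀ i, 1 ≤ i → (1 - t * q ^ i) * A i = 1) (B : ℕ) :
    q ^ B ∣ fineSum q t A 0 B -
      ∑ M ∈ range B, (∏ j ∈ range M, -(t * q ^ (j + 3) * A (j + 2))) * A (M + 2) * A (M + 1) := by
  have h := pow_dvd_fineSum_sub hA B B
  have hd : q ^ B ∣ ∏ j ∈ range B, -(t * q ^ (j + 3) * A (j + 2)) := by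
    rw [← card_range B, ← prod_const, card_range]
    exact prod_dvd_prod_of_dvd _ _ fun j _ =>
      ⟨-(t * q ^ (j + 2) * A (j + 2)), by ring⟩
  have := dvd_add h (hd.mul_right (fineSum q t A B B))
  convert this using 1
  ring

end TruncatedIdentity

section GeneratingFunctions

open PowerSeries

/-- The power series `∑ c, h c * X ^ (i * c)`, enumerating the multiplicities `c` of a part `i`
with weight `h c`. -/
noncomputable def partSeries (i : ℕ) (h : ℕ → ℂ) : ℂ⟦X⟧ :=
  PowerSeries.mk fun m => if i ∣ m then h (m / i) else 0

theorem coeff_prod_partSeries (S : Finset ℕ) (hS : 0 ∉ S) (h : ℕ → ℕ → ℂ) (n : ℕ) :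
    coeff n (∏ i ∈ S, partSeries i (h i)) =
      ∑ p ∈ (univ : Finset n.Partition).filter (fun p => ∀ i ∈ p.parts, i ∈ S),
        ∏ i ∈ S, h i (mult p i) := by
  have hfun (p : n.Partition) (i : ℕ) : p.toFinsuppAntidiag i = p.parts.count i * i := rfl
  rw [PowerSeries.coeff_prod]
  symm
  refine sum_of_injOn Nat.Partition.toFinsuppAntidiag
    (Nat.Partition.toFinsuppAntidiag_injective n).injOn ?_ ?_ ?_
  · intro p hp
    have hp : ∀ i ∈ p.parts, i ∈ S := by simpa using hp
    have hm := p.toFinsuppAntidiag_mem_finsuppAntidiag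
    rw [mem_finsuppAntidiag'] at hm
    rw [mem_coe, mem_finsuppAntidiag']
    refine ⟨hm.1, fun i hi => hp i ?_⟩
    rw [Finsupp.mem_support_iff, hfun] at hi
    exact Multiset.count_ne_zero.1 (left_ne_zero_of_mul hi)
  · intro g hg hg'
    by_contra hne
    have hdvd (i : ℕ) : i ∣ g i := by
      by_cases hi : i ∈ S
      · by_contra hd
        refine hne (prod_eq_zero hi ?_)
        simp [partSeries, hd]
      · have : g i = 0 := by
          by_contra h0
          exact hi ((mem_finsuppAntidiag.1 hg).2 (Finsupp.mem_support_iff.2 h0))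
        simp [this]
    have hpos (i : ℕ) (hi : g i ≠ 0) : i ≠ 0 := by
      rintro rfl
      exact hS ((mem_finsuppAntidiag.1 hg).2 (Finsupp.mem_support_iff.2 hi))
    have hquot (i : ℕ) : g i ≠ 0 ↔ g i / i ≠ 0 := by
      constructor
      · intro hi
        exact (Nat.div_pos (Nat.le_of_dvd (Nat.pos_of_ne_zero hi) (hdvd i))
          (Nat.pos_of_ne_zero (hpos i hi))).ne'
      · intro hi h0
        simp [h0] at hi
    refine hg' ?_
    let f : ℕ →₀ ℕ := ⟨g.support, fun i => g i / i, fun i => by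
      rw [Finsupp.mem_support_iff]; exact hquot i⟩
    have hf : ∀ i ∈ f.toMultiset, g i ≠ 0 := fun i hi => by
      simpa [f] using hi
    refine ⟨⟨f.toMultiset, fun {i} hi => Nat.pos_of_ne_zero (hpos i (hf i hi)), ?_⟩, ?_, ?_⟩
    · refine Eq.trans ?_ (mem_finsuppAntidiag'.1 hg).1
      suffices ∑ i ∈ g.support, g i / i * i = ∑ i ∈ g.support, g i by simpa [Finsupp.sum, f]
      exact sum_congr rfl fun i _ => Nat.div_mul_cancel (hdvd i)
    · simp only [coe_filter, mem_univ, true_and, Set.mem_ofPred_eq]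
      intro i hi
      exact (mem_finsuppAntidiag.1 hg).2 (Finsupp.mem_support_iff.2 (hf i hi))
    · ext i
      rw [hfun]
      simpa [f] using Nat.div_mul_cancel (hdvd i)
  · intro p _
    refine prod_congr rfl fun i hi => ?_
    have hi0 : 0 < i := Nat.pos_of_ne_zero fun h0 => hS (h0 ▸ hi)
    simp [partSeries, hfun, mult, Nat.mul_div_cancel _ hi0]

variable (t : ℂ)

theorem one_sub_mul_partSeries {i : ℕ} (hi : 1 ≤ i) (h : ℕ → ℂ) :
    (1 - C t * X ^ i) * partSeries i h =
      partSeries i (fun c => h c - if c = 0 then 0 else t * h (c - 1)) := by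
  ext m
  rw [sub_mul, one_mul, map_sub, mul_assoc, coeff_C_mul, coeff_X_pow_mul']
  simp only [partSeries, coeff_mk]
  by_cases hd : i ∣ m
  · obtain ⟨c, rfl⟩ := hd
    rw [Nat.mul_div_cancel_left _ hi]
    rcases c with _ | c
    · simp [show ¬ i ≤ 0 by omega]
    · have : i * (c + 1) - i = i * c := by rw [mul_add]; omega
      simp [this, Nat.mul_div_cancel_left _ (show 0 < i from hi), show i ≤ i * (c + 1) by nlinarith]
  · have : i ≤ m → ¬ i ∣ m - i := fun hle hd' => hd (by
      simpa [Nat.sub_add_cancel hle] using Nat.dvd_add hd' (dvd_refl i))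
    by_cases hle : i ≤ m <;> simp [hd, hle, this]

theorem partSeries_of_support_le_one {i : ℕ} (hi : 1 ≤ i) {h : ℕ → ℂ} (h2 : ∀ c, 2 ≤ c → h c = 0) :
    partSeries i h = C (h 0) + C (h 1) * X ^ i := by
  ext m
  rw [map_add, coeff_C_mul, coeff_X_pow, coeff_C]
  simp only [partSeries, coeff_mk]
  by_cases hd : i ∣ m
  · obtain ⟨c, rfl⟩ := hd
    rw [Nat.mul_div_cancel_left _ hi]
    rcases c with _ | _ | c
    · simp [show 0 ≠ i by omega]
    · simp [show i ≠ 0 by omega]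
    · have : i * (c + 2) ≠ i := by nlinarith
      simp [this, h2, show i ≠ 0 by omega]
  · have h0 : m ≠ 0 := by rintro rfl; simp at hd
    have h1 : m ≠ i := by rintro rfl; simp at hd
    simp [hd, h0, h1]

theorem one_sub_mul_partSeries_pow {i : ℕ} (hi : 1 ≤ i) :
    (1 - C t * X ^ i) * partSeries i (fun c => t ^ c) = 1 := by
  rw [one_sub_mul_partSeries t hi, partSeries_of_support_le_one hi]
  · simp
  · rintro (_ | c) hc
    · omega
    · simp [pow_succ']

theorem partSeries_pos_eq {i : ℕ} (hi : 1 ≤ i) :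
    partSeries i (fun c => t ^ c * if c = 0 then 0 else 1) =
      C t * X ^ i * partSeries i (fun c => t ^ c) := by
  have hA := one_sub_mul_partSeries_pow t hi
  have hB : (1 - C t * X ^ i) * partSeries i (fun c => t ^ c * if c = 0 then 0 else 1) =
      C t * X ^ i := by
    rw [one_sub_mul_partSeries t hi, partSeries_of_support_le_one hi]
    · simp
    · rintro (_ | _ | c) hc
      · omega
      · omega
      · simp [pow_succ']
  linear_combination partSeries i (fun c => t ^ c) * hB -
    partSeries i (fun c => t ^ c * if c = 0 then 0 else 1) * hA

theorem partSeries_distinct_eq (ht : t ≠ 0) {i : ℕ} (hi : 1 ≤ i) :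
    partSeries i (fun c => t ^ c * if c = 0 then 1 else 1 - 1 / t) =
      (1 - X ^ i) * partSeries i (fun c => t ^ c) := by
  have hA := one_sub_mul_partSeries_pow t hi
  have hB : (1 - C t * X ^ i) * partSeries i (fun c => t ^ c * if c = 0 then 1 else 1 - 1 / t) =
      1 - X ^ i := by
    rw [one_sub_mul_partSeries t hi, partSeries_of_support_le_one hi]
    · have h1 : (C t * C t⁻¹ : ℂ⟦X⟧) = 1 := by rw [← map_mul, mul_inv_cancel₀ ht, map_one]
      simp only [one_div, pow_zero, pow_one, if_true, one_ne_zero, if_false, Nat.sub_self,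
        map_sub, map_mul, map_one, map_zero]
      linear_combination -X ^ i * h1
    · rintro (_ | _ | c) hc
      · omega
      · omega
      · simp only [Nat.add_eq_zero_iff, one_ne_zero, and_false, if_false, Nat.add_sub_cancel]
        ring
  linear_combination partSeries i (fun c => t ^ c) * hB -
    partSeries i (fun c => t ^ c * if c = 0 then 1 else 1 - 1 / t) * hA

theorem partSeries_mult_eq {i : ℕ} (hi : 1 ≤ i) :
    partSeries i (fun c => t ^ c * c) = C t * X ^ i * partSeries i (fun c => t ^ c) ^ 2 := by
  have hA := one_sub_mul_partSeries_pow t hi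
  have hB : (1 - C t * X ^ i) * partSeries i (fun c => t ^ c * c) =
      C t * X ^ i * partSeries i (fun c => t ^ c) := by
    rw [one_sub_mul_partSeries t hi, ← partSeries_pos_eq t hi]
    congr 1
    funext c
    rcases c with _ | c
    · simp
    · simp only [Nat.add_eq_zero_iff, one_ne_zero, and_false, if_false, Nat.add_sub_cancel]
      push_cast
      ring
  linear_combination partSeries i (fun c => t ^ c) * hB -
    partSeries i (fun c => t ^ c * c) * hA

end GeneratingFunctions

section PartStatistics

variable {n : ℕ} (p : n.Partition)

theorem le_largestPart {j : ℕ} (hj : j ∈ p.parts) : j ≤ largestPart p :=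
  le_sup (f := id) (Multiset.mem_toFinset.2 hj)

theorem smallestPart_le {j : ℕ} (hj : j ∈ p.parts) : smallestPart p ≤ j :=
  Nat.sInf_le hj

theorem exists_mem_parts (hn : 0 < n) : ∃ j, j ∈ p.parts := by
  refine Multiset.exists_mem_of_ne_zero fun h0 => hn.ne ?_
  rw [← p.parts_sum, h0, Multiset.sum_zero]

theorem smallestPart_mem (hn : 0 < n) : smallestPart p ∈ p.parts :=
  Nat.sInf_mem (s := {j | j ∈ p.parts}) (exists_mem_parts p hn)

theorem largestPart_mem (hn : 0 < n) : largestPart p ∈ p.parts := by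
  obtain ⟨j, hj⟩ := exists_mem_parts p hn
  obtain ⟨i, hi, h⟩ := exists_mem_eq_sup p.parts.toFinset ⟨j, Multiset.mem_toFinset.2 hj⟩ id
  rw [largestPart, h]
  exact Multiset.mem_toFinset.1 hi

theorem largestPart_eq_iff (hn : 0 < n) (L : ℕ) :
    largestPart p = L ↔ L ∈ p.parts ∧ ∀ j ∈ p.parts, j ≤ L := by
  constructor
  · rintro rfl
    exact ⟨largestPart_mem p hn, fun j => le_largestPart p⟩
  · rintro ⟨h1, h2⟩
    exact le_antisymm (h2 _ (largestPart_mem p hn)) (le_largestPart p h1)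

theorem le_smallestPart_iff (hn : 0 < n) (s : ℕ) :
    s ≤ smallestPart p ↔ ∀ j ∈ p.parts, s ≤ j :=
  ⟨fun h _ hj => h.trans (smallestPart_le p hj), fun h => h _ (smallestPart_mem p hn)⟩

theorem mult_eq_zero_iff (j : ℕ) : mult p j = 0 ↔ j ∉ p.parts :=
  Multiset.count_eq_zero

theorem prod_pow_mult {S : Finset ℕ} (hS : ∀ j ∈ p.parts, j ∈ S) (t : ℂ) :
    ∏ i ∈ S, t ^ mult p i = t ^ numParts p := by
  rw [prod_pow_eq_pow_sum]
  congr 1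
  exact Multiset.sum_count_eq_card hS

end PartStatistics

section Fibers

open PowerSeries

variable {n : ℕ} (t : ℂ)

theorem sum_parts_ge_two_largestPart_eq (hn : 0 < n) (ht : t ≠ 0) (N : ℕ) :
    ∑ p ∈ (univ : Finset n.Partition).filter
        (fun p => 2 ≤ smallestPart p ∧ largestPart p = N + 2),
        t ^ (largestPart p + numParts p - 2) * (1 - 1 / t) ^ (numDistinctParts p - 1) =
      coeff n (C t * X ^ 2 * ((C t * X ^ (0 + 1)) ^ N * (∏ j ∈ range N, (1 - X ^ (j + 2))) *
        ∏ j ∈ range (N + 1), partSeries (0 + 2 + j) fun c => t ^ c)) := by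
  have key : C t * X ^ 2 * ((C t * X ^ (0 + 1)) ^ N * (∏ j ∈ range N, (1 - X ^ (j + 2))) *
        ∏ j ∈ range (N + 1), partSeries (0 + 2 + j) fun c => t ^ c) =
      C (t ^ N) * ∏ i ∈ Ico 2 (N + 3), partSeries i (fun c => t ^ c *
        if i = N + 2 then (if c = 0 then 0 else 1) else if c = 0 then 1 else 1 - 1 / t) := by
    rw [prod_Ico_eq_prod_range, show N + 3 - 2 = N + 1 by omega, prod_range_succ, prod_range_succ]
    have h1 : ∀ j ∈ range N, partSeries (2 + j) (fun c => t ^ c *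
        if 2 + j = N + 2 then (if c = 0 then 0 else 1) else if c = 0 then 1 else 1 - 1 / t) =
        (1 - X ^ (j + 2)) * partSeries (0 + 2 + j) (fun c => t ^ c) := by
      intro j hj
      rw [mem_range] at hj
      simp only [show 2 + j ≠ N + 2 by omega, if_false]
      rw [partSeries_distinct_eq t ht (by omega), add_comm j 2, Nat.zero_add]
    rw [prod_congr rfl h1, prod_mul_distrib]
    simp only [show 2 + N = N + 2 by omega, if_true, Nat.zero_add]
    rw [partSeries_pos_eq t (by omega), map_pow]
    ring
  rw [key, coeff_C_mul, coeff_prod_partSeries _ (by simp), mul_sum]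
  refine sum_subset_zero_on_sdiff ?_ ?_ ?_
  · intro p hp
    simp only [mem_filter, mem_univ, true_and, mem_Ico] at hp ⊢
    intro i hi
    have := smallestPart_le p hi
    have := le_largestPart p hi
    omega
  · intro p hp
    simp only [mem_sdiff, mem_filter, mem_univ, true_and, mem_Ico] at hp
    have hL : N + 2 ∉ p.parts := fun hL => hp.2
      ⟨(le_smallestPart_iff p hn 2).2 fun j hj => (hp.1 j hj).1,
        (largestPart_eq_iff p hn _).2 ⟨hL, fun j hj => by have := (hp.1 j hj).2; omega⟩⟩
    refine mul_eq_zero_of_right _ (prod_eq_zero (i := N + 2) (by simp) ?_)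
    simp [(mult_eq_zero_iff p _).2 hL]
  · intro p hp
    simp only [mem_filter, mem_univ, true_and] at hp
    obtain ⟨hs, hl⟩ := hp
    have hS : ∀ j ∈ p.parts, j ∈ Ico 2 (N + 3) := fun j hj => by
      have := smallestPart_le p hj
      have := le_largestPart p hj
      rw [mem_Ico]
      omega
    have hL : N + 2 ∈ p.parts := hl ▸ largestPart_mem p hn
    rw [prod_mul_distrib, prod_pow_mult p hS, ← mul_assoc, ← pow_add, hl,
      show N + 2 + numParts p - 2 = N + numParts p by omega]
    congr 1
    have h1 : ∀ i ∈ Ico 2 (N + 3), (if i = N + 2 then (if mult p i = 0 then (0 : ℂ) else 1)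
        else if mult p i = 0 then 1 else 1 - 1 / t) =
        if i ∈ p.parts.toFinset.erase (N + 2) then 1 - 1 / t else 1 := by
      intro i _
      simp only [mult_eq_zero_iff, mem_erase, Multiset.mem_toFinset]
      by_cases hi : i = N + 2
      · subst hi; simp [hL]
      · by_cases hm : i ∈ p.parts <;> simp [hi, hm]
    rw [prod_congr rfl h1, ← prod_filter, prod_const, numDistinctParts,
      ← card_erase_of_mem (Multiset.mem_toFinset.2 hL)]
    congr 2
    ext i
    simp only [mem_filter, mem_erase, Multiset.mem_toFinset]
    exact ⟨fun h => ⟨hS i h.2, h⟩, fun h => h.2⟩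

theorem sum_largestPart_eq_two (hn : 0 < n) :
    ∑ p ∈ (univ : Finset n.Partition).filter (fun p => largestPart p = 2), t ^ numParts p =
      coeff n (C t * X ^ 2 * (partSeries 2 (fun c => t ^ c) * partSeries 1 (fun c => t ^ c))) := by
  have key : C t * X ^ 2 * (partSeries 2 (fun c => t ^ c) * partSeries 1 (fun c => t ^ c)) =
      ∏ i ∈ {1, 2}, partSeries i (fun c => t ^ c * if i = 2 ∧ c = 0 then 0 else 1) := by
    rw [prod_pair (by simp)]
    simp only [OfNat.one_ne_ofNat, false_and, if_false, true_and, mul_one]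
    rw [partSeries_pos_eq t (by omega)]
    ring
  rw [key, coeff_prod_partSeries _ (by simp)]
  refine sum_subset_zero_on_sdiff ?_ ?_ ?_
  · intro p hp
    simp only [mem_filter, mem_univ, true_and, mem_insert, mem_singleton] at hp ⊢
    intro i hi
    have := p.parts_pos hi
    have := le_largestPart p hi
    omega
  · intro p hp
    simp only [mem_sdiff, mem_filter, mem_univ, true_and, mem_insert, mem_singleton] at hp
    have hL : 2 ∉ p.parts := fun hL => hp.2
      ((largestPart_eq_iff p hn _).2 ⟨hL, fun j hj => by have := hp.1 j hj; omega⟩)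
    refine prod_eq_zero (i := 2) (by simp) ?_
    simp [(mult_eq_zero_iff p _).2 hL]
  · intro p hp
    simp only [mem_filter, mem_univ, true_and] at hp
    have hS : ∀ j ∈ p.parts, j ∈ ({1, 2} : Finset ℕ) := fun j hj => by
      have := p.parts_pos hj
      have := le_largestPart p hj
      simp only [mem_insert, mem_singleton]
      omega
    have hL : mult p 2 ≠ 0 := by
      rw [Ne, mult_eq_zero_iff, not_not, ← hp]
      exact largestPart_mem p hn
    rw [prod_mul_distrib, prod_pow_mult p hS, prod_pair (by simp)]
    simp [hL]

theorem sum_P1star_largestPart_eq (hn : 0 < n) (m : ℕ) :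
    ∑ p ∈ (P1star n).filter (fun p => smallestPart p = 2 ∧ largestPart p = m + 3),
        (-1 : ℂ) ^ largestPart p * t ^ numParts p * (mult p (largestPart p - 1) : ℂ) =
      coeff n (C t * X ^ 2 * ((∏ j ∈ range (m + 1),
        -(C t * X ^ (j + 3) * partSeries (j + 2) fun c => t ^ c)) *
          partSeries (m + 1 + 2) (fun c => t ^ c) * partSeries (m + 1 + 1) fun c => t ^ c)) := by
  have key : C t * X ^ 2 * ((∏ j ∈ range (m + 1),
        -(C t * X ^ (j + 3) * partSeries (j + 2) fun c => t ^ c)) *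
          partSeries (m + 1 + 2) (fun c => t ^ c) * partSeries (m + 1 + 1) fun c => t ^ c) =
      C ((-1) ^ (m + 3)) * ∏ i ∈ Ico 2 (m + 4), partSeries i (fun c => t ^ c *
        if i = m + 2 then (c : ℂ) else if c = 0 then 0 else 1) := by
    conv_rhs =>
      rw [prod_Ico_eq_prod_range, show m + 4 - 2 = m + 2 by omega, prod_range_succ,
        prod_range_succ]
    have h1 : ∀ j ∈ range m, partSeries (2 + j) (fun c => t ^ c *
        if 2 + j = m + 2 then (c : ℂ) else if c = 0 then 0 else 1) =
        C t * X ^ (j + 2) * partSeries (j + 2) (fun c => t ^ c) := by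
      intro j hj
      rw [mem_range] at hj
      simp only [show 2 + j ≠ m + 2 by omega, if_false]
      rw [partSeries_pos_eq t (by omega), add_comm j 2]
    rw [prod_congr rfl h1]
    simp only [show 2 + m = m + 2 by omega, show 2 + (m + 1) = m + 3 by omega, if_true,
      show m + 3 ≠ m + 2 by omega, if_false]
    rw [partSeries_pos_eq t (by omega), partSeries_mult_eq t (by omega)]
    have h2 (k : ℕ) : X ^ 2 * ∏ j ∈ range k, -(C t * X ^ (j + 3) *
        partSeries (j + 2) fun c => t ^ c) = C ((-1) ^ k) * X ^ (k + 2) *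
          ∏ j ∈ range k, C t * X ^ (j + 2) * partSeries (j + 2) fun c => t ^ c := by
      induction k with
      | zero => simp
      | succ k ih =>
        rw [prod_range_succ, prod_range_succ, ← mul_assoc, ih, pow_succ (-1 : ℂ), map_mul,
          map_neg, map_one]
        ring
    rw [show m + 1 + 2 = m + 3 by omega, show m + 1 + 1 = m + 2 by omega]
    have h3 := h2 (m + 1)
    rw [prod_range_succ (fun j => C t * X ^ (j + 2) * partSeries (j + 2) fun c => t ^ c)] at h3
    rw [show ((-1 : ℂ)) ^ (m + 3) = (-1) ^ (m + 1) by ring]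
    linear_combination (C t * partSeries (m + 3) (fun c => t ^ c) *
      partSeries (m + 2) (fun c => t ^ c)) * h3
  rw [key, coeff_C_mul, coeff_prod_partSeries _ (by simp), mul_sum]
  refine sum_subset_zero_on_sdiff ?_ ?_ ?_
  · intro p hp
    simp only [mem_filter, mem_univ, true_and, mem_Ico] at hp ⊢
    intro i hi
    have := smallestPart_le p hi
    have := le_largestPart p hi
    omega
  · intro p hp
    simp only [mem_sdiff, mem_filter, mem_univ, true_and, mem_Ico, P1star] at hp
    obtain ⟨i, hi, hip⟩ : ∃ i ∈ Ico 2 (m + 4), i ∉ p.parts := by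
      by_contra! hall
      have hl : largestPart p = m + 3 := (largestPart_eq_iff p hn _).2
        ⟨hall _ (by simp), fun j hj => by have := (hp.1 j hj).2; omega⟩
      have hs : smallestPart p = 2 := le_antisymm (smallestPart_le p (hall 2 (by simp)))
        ((le_smallestPart_iff p hn 2).2 fun j hj => (hp.1 j hj).1)
      exact hp.2 ⟨fun j h1 h2 => hall j (by rw [mem_Ico]; omega), hs, hl⟩
    refine mul_eq_zero_of_right _ (prod_eq_zero hi ?_)
    simp [(mult_eq_zero_iff p _).2 hip]
  · intro p hp
    simp only [mem_filter, mem_univ, true_and, P1star] at hp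
    obtain ⟨hall, hs, hl⟩ := hp
    have hS : ∀ j ∈ p.parts, j ∈ Ico 2 (m + 4) := fun j hj => by
      have := smallestPart_le p hj
      have := le_largestPart p hj
      rw [mem_Ico]
      omega
    rw [prod_mul_distrib, prod_pow_mult p hS, ← mul_assoc, hl]
    congr 1
    rw [prod_eq_single_of_mem (m + 2) (by simp)]
    · simp
    · intro i hi hne
      rw [mem_Ico] at hi
      have : mult p i ≠ 0 := by
        rw [Ne, mult_eq_zero_iff, not_not]
        exact hall i (by omega) (by omega)
      simp [hne, this]

end Fibers

theorem stmt19 (n : ℕ) (hn : 0 < n) (t : ℂ) (ht : t ≠ 0) :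
    ∑ p ∈ (Finset.univ : Finset (n.Partition)).filter (fun p => 2 ≤ smallestPart p),
        t ^ (largestPart p + numParts p - 2) * (1 - 1 / t) ^ (numDistinctParts p - 1)
      = (∑ p ∈ (Finset.univ : Finset (n.Partition)).filter (fun p => largestPart p = 2),
            t ^ numParts p)
        + ∑ p ∈ (P1star n).filter (fun p => smallestPart p = 2 ∧ 3 ≤ largestPart p),
            (-1 : ℂ) ^ largestPart p * t ^ numParts p * (mult p (largestPart p - 1) : ℂ) := by
  open PowerSeries in
  have hA : ∀ i, 1 ≤ i → (1 - C t * X ^ i : ℂ⟦X⟧) * partSeries i (fun c => t ^ c) = 1 :=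
    fun i hi => one_sub_mul_partSeries_pow t hi
  have hcongr := pow_dvd_fineSum_sub_sum hA n
  have hcoeff : ∀ f g : PowerSeries ℂ, PowerSeries.X ^ n ∣ f - g →
      PowerSeries.coeff n (PowerSeries.C t * PowerSeries.X ^ 2 * f) =
        PowerSeries.coeff n (PowerSeries.C t * PowerSeries.X ^ 2 * g) := by
    intro f g hfg
    rw [← sub_eq_zero, ← map_sub, ← mul_sub]
    refine (PowerSeries.X_pow_dvd_iff (n := n + 1)).1 ?_ n (by omega)
    rw [pow_succ', mul_comm (PowerSeries.C t), mul_assoc, pow_two, mul_assoc]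
    exact mul_dvd_mul_left _ ((hfg.mul_left _).mul_left _)
  have hmain := hcoeff _ _ hcongr
  obtain ⟨k, rfl⟩ := Nat.exists_eq_add_of_lt hn
  rw [Nat.zero_add] at *
  have hle (p : (k + 1).Partition) : largestPart p ≤ k + 1 :=
    p.le_of_mem_parts (largestPart_mem p hn)
  rw [fineSum, mul_sum, map_sum] at hmain
  conv_rhs at hmain =>
    rw [sum_range_succ', mul_add, map_add, mul_sum, map_sum, add_comm]
  simp only [← sum_parts_ge_two_largestPart_eq t hn ht, ← sum_P1star_largestPart_eq t hn] at hmain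
  rw [range_zero, prod_empty, one_mul, Nat.zero_add, Nat.zero_add,
    ← sum_largestPart_eq_two t hn] at hmain
  rw [← sum_fiberwise_of_maps_to (s := univ.filter fun p : (k + 1).Partition => 2 ≤ smallestPart p)
    (t := range (k + 1)) (g := fun p => largestPart p - 2),
    ← sum_fiberwise_of_maps_to (s := (P1star (k + 1)).filter
      fun p => smallestPart p = 2 ∧ 3 ≤ largestPart p)
    (t := range k) (g := fun p => largestPart p - 3)]
  · convert hmain using 2
    · refine sum_congr ?_ fun _ _ => rfl
      rw [filter_filter]
      refine filter_congr fun p _ => and_congr_right fun hs => ?_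
      have := hs.trans (smallestPart_le p (largestPart_mem p hn))
      omega
    · refine sum_congr rfl fun m _ => sum_congr ?_ fun _ _ => rfl
      rw [filter_filter]
      refine filter_congr fun p _ => ?_
      omega
  · intro p hp
    have := hle p
    rw [mem_filter] at hp
    rw [mem_range]
    omega
  · intro p _
    have := hle p
    rw [mem_range]
    omega
end
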